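/- Let d ≥ 1 and c ≥ 0. For each n ≥ 1 let A_n be a nonempty, convex, compact, permutation-invariant set of density matrices on (ℂ^d)^{⊗n} and B_n a nonempty, convex, compact, permutation-invariant set of positive semidefinite matrices on (ℂ^d)^{⊗n}, such that: A_m ⊗ A_k ⊆ A_{m+k} and B_m ⊗ B_k ⊆ B_{m+k} for all m,k ≥ 1 (under the natural identification (ℂ^d)^{⊗m} ⊗ (ℂ^d)^{⊗k} ≅ (ℂ^d)^{⊗(m+k)}); (A_m)°₊ ⊗ (A_k)°₊ ⊆ (A_{m+k})°₊ and (B_m)°₊ ⊗ (B_k)°₊ ⊆ (B_{m+k})°₊ for all m,k ≥ 1; and inf_{ρ∈A_n, σ∈B_n} D_max(ρ‖σ) ≤ c·n for all n ≥ 1. Then for every m ≥ 1: 0 ≤ D(A_m‖B_m) − D_M(A_m‖B_m) ≤ 2(d² + d) · log(m + d). -/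

import Mathlib

open scoped Kronecker ComplexOrder Matrix

attribute [local instance] Classical.propDecidable

noncomputable section

namespace QIT

variable {n : Type*} [Fintype n] [DecidableEq n]

/-- Base-2 matrix logarithm taken on the support (junk value `0` for non-Hermitian input). -/
def matLog (A : Matrix n n ℂ) : Matrix n n ℂ :=
  if hA : A.IsHermitian then
    (hA.eigenvectorUnitary : Matrix n n ℂ) *
      Matrix.diagonal (fun i => if hA.eigenvalues i = 0 then (0 : ℂ)
        else (Real.logb 2 (hA.eigenvalues i) : ℂ)) *
      (hA.eigenvectorUnitary : Matrix n n ℂ)ᴴ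
  else 0

/-- Orthogonal projection onto the support of a Hermitian matrix. -/
def suppProj (A : Matrix n n ℂ) : Matrix n n ℂ :=
  if hA : A.IsHermitian then
    (hA.eigenvectorUnitary : Matrix n n ℂ) *
      Matrix.diagonal (fun i => if hA.eigenvalues i = 0 then (0 : ℂ) else 1) *
      (hA.eigenvectorUnitary : Matrix n n ℂ)ᴴ
  else 0

/-- Support inclusion `supp ρ ⊆ supp σ`, phrased via kernels. -/
def suppLE (ρ σ : Matrix n n ℂ) : Prop :=
  ∀ x : n → ℂ, σ.mulVec x = 0 → ρ.mulVec x = 0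

/-- Umegaki relative entropy (base 2), `+∞` when supports are not included. -/
def relEnt (ρ σ : Matrix n n ℂ) : EReal :=
  if suppLE ρ σ then (((ρ * (matLog ρ - matLog σ)).trace).re : EReal) else ⊤

/-- Classical relative-entropy summand `p log₂(p/q)` with conventions
`0 · log(0/q) = 0` and `p · log(p/0) = +∞` for `p ≠ 0`. -/
def klTerm (p q : ℝ) : EReal :=
  if p = 0 then 0 else if q = 0 then ⊤ else ((p * Real.logb 2 (p / q) : ℝ) : EReal)

/-- A finite POVM. -/
def IsPOVM {m : ℕ} (M : Fin m → Matrix n n ℂ) : Prop :=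
  (∀ x, (M x).PosSemidef) ∧ ∑ x, M x = 1

/-- Measured relative entropy (base 2). -/
def measRelEnt (ρ σ : Matrix n n ℂ) : EReal :=
  ⨆ (m : ℕ) (M : Fin m → Matrix n n ℂ) (_ : IsPOVM M),
    ∑ x, klTerm ((M x * ρ).trace).re ((M x * σ).trace).re

/-- Trace norm: sum of singular values. -/
def traceNorm (A : Matrix n n ℂ) : ℝ :=
  ∑ i, Real.sqrt ((Matrix.posSemidef_conjTranspose_mul_self A).1.eigenvalues i)

/-- Operator (spectral) norm: largest singular value. -/
def opNorm (A : Matrix n n ℂ) : ℝ :=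
  ⨆ i, Real.sqrt ((Matrix.posSemidef_conjTranspose_mul_self A).1.eigenvalues i)

/-- Partial transpose on the second tensor factor. -/
def ptB {α β : Type*} (X : Matrix (α × β) (α × β) ℂ) : Matrix (α × β) (α × β) ℂ :=
  Matrix.of fun p q => X (p.1, q.2) (q.1, p.2)

/-- Kronecker product of two bipartite matrices, reindexed to the bipartition (A×A') : (B×B'). -/
def kron2 {α β γ δ : Type*} (X : Matrix (α × β) (α × β) ℂ) (Y : Matrix (γ × δ) (γ × δ) ℂ) :
    Matrix ((α × γ) × β × δ) ((α × γ) × β × δ) ℂ :=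
  Matrix.reindex (Equiv.prodProdProdComm α β γ δ) (Equiv.prodProdProdComm α β γ δ) (X ⊗ₖ Y)

/-- The permutation unitary on `(ℂ^d)^{⊗ m}`. -/
def permMat (d m : ℕ) (π : Equiv.Perm (Fin m)) :
    Matrix (Fin m → Fin d) (Fin m → Fin d) ℂ :=
  Matrix.of fun f g => if f ∘ π = g then 1 else 0

/-- Membership in the `PPT_k` set. -/
def memPPTk {α β : Type*} [Fintype α] [Fintype β] [DecidableEq α] [DecidableEq β]
    (k : ℕ) (X : Matrix (α × β) (α × β) ℂ) : Prop :=
  X.PosSemidef ∧ ∃ ω : ℕ → Matrix (α × β) (α × β) ℂ,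
    ω 1 = X ∧ (∀ i ∈ Finset.Icc 1 k, (ω i).IsHermitian) ∧
    (∀ i ∈ Finset.Icc 1 (k - 1),
      ((ω (i + 1)) - ptB (ω i)).PosSemidef ∧ ((ω (i + 1)) + ptB (ω i)).PosSemidef) ∧
    traceNorm (ptB (ω k)) ≤ 1

/-- Membership in the Rains set. -/
def memRains {α β : Type*} [Fintype α] [Fintype β] [DecidableEq α] [DecidableEq β]
    (σ : Matrix (α × β) (α × β) ℂ) : Prop :=
  σ.PosSemidef ∧ traceNorm (ptB σ) ≤ 1


/-- A set of matrices on `(ℂ^d)^{⊗n}` is permutation invariant. -/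
def PermInvSet (d n : ℕ) (S : Set (Matrix (Fin n → Fin d) (Fin n → Fin d) ℂ)) : Prop :=
  ∀ π : Equiv.Perm (Fin n),
    (fun X => permMat d n π * X * (permMat d n π)ᴴ) '' S = S

/-- The polar set restricted to positive semidefinite matrices. -/
def polarPlus {I : Type*} [Fintype I] [DecidableEq I] (C : Set (Matrix I I ℂ)) :
    Set (Matrix I I ℂ) :=
  {X | X.PosSemidef ∧ ∀ Y ∈ C, ((X * Y).trace).re ≤ 1}

/-- The natural identification `(ℂ^d)^{⊗m} ⊗ (ℂ^d)^{⊗k} ≅ (ℂ^d)^{⊗(m+k)}` on indices. -/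
def tensorEquiv (d m k : ℕ) : ((Fin m → Fin d) × (Fin k → Fin d)) ≃ (Fin (m + k) → Fin d) :=
  (Equiv.sumArrowEquivProdArrow (Fin m) (Fin k) (Fin d)).symm.trans
    (Equiv.arrowCongr finSumFinEquiv (Equiv.refl (Fin d)))

/-- Kronecker product of matrices on `(ℂ^d)^{⊗m}` and `(ℂ^d)^{⊗k}`, viewed on
`(ℂ^d)^{⊗(m+k)}`. -/
def tensorJoin {d m k : ℕ} (X : Matrix (Fin m → Fin d) (Fin m → Fin d) ℂ)
    (Y : Matrix (Fin k → Fin d) (Fin k → Fin d) ℂ) :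
    Matrix (Fin (m + k) → Fin d) (Fin (m + k) → Fin d) ℂ :=
  Matrix.reindex (tensorEquiv d m k) (tensorEquiv d m k) (X ⊗ₖ Y)

/-- Max-relative entropy (base 2). -/
def Dmax {I : Type*} [Fintype I] [DecidableEq I] (ρ σ : Matrix I I ℂ) : EReal :=
  ⨅ (t : ℝ) (_ : ((t : ℂ) • σ - ρ).PosSemidef), (Real.logb 2 t : EReal)

/-- Umegaki relative entropy between two sets of matrices. -/
def relEntSet {I : Type*} [Fintype I] [DecidableEq I] (A B : Set (Matrix I I ℂ)) : EReal :=
  ⨅ ρ ∈ A, ⨅ σ ∈ B, relEnt ρ σ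

/-- Measured relative entropy between two sets of matrices. -/
def measRelEntSet {I : Type*} [Fintype I] [DecidableEq I] (A B : Set (Matrix I I ℂ)) : EReal :=
  ⨅ ρ ∈ A, ⨅ σ ∈ B, measRelEnt ρ σ


theorem exists_joint_eigenbasis {S T : Matrix n n ℂ} (hS : S.IsHermitian)
    (hT : T.IsHermitian) (hST : S * T = T * S) :
    ∃ (g : OrthonormalBasis n ℂ (EuclideanSpace ℂ n)) (a b : n → ℂ),
      (∀ k, Matrix.toEuclideanLin S (g k) = a k • g k) ∧
      (∀ k, Matrix.toEuclideanLin T (g k) = b k • g k) := by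
  have hS' := Matrix.isSymmetric_toEuclideanLin_iff.mpr hS
  have hT' := Matrix.isSymmetric_toEuclideanLin_iff.mpr hT
  have hcomm : Commute (Matrix.toEuclideanLin S) (Matrix.toEuclideanLin T) := by
    refine LinearMap.ext fun x => ?_
    simp only [Module.End.mul_apply]
    simp [Matrix.toLpLin_apply, Matrix.mulVec_mulVec, hST]
  have hI := DirectSum.isInternal_ne_bot_iff.mpr
    (LinearMap.IsSymmetric.directSum_isInternal_of_commute hS' hT' hcomm)
  have hO := (LinearMap.IsSymmetric.orthogonalFamily_eigenspace_inf_eigenspace hS' hT').comp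
    (Subtype.val_injective (p := fun i : ℂ × ℂ =>
      Module.End.eigenspace (Matrix.toEuclideanLin S) i.2 ⊓
        Module.End.eigenspace (Matrix.toEuclideanLin T) i.1 ≠ ⊥))
  have := iSupIndep.fintypeNeBotOfFiniteDimensional
    (LinearMap.IsSymmetric.directSum_isInternal_of_commute hS' hT' hcomm).submodule_iSupIndep
  let g := (hI.subordinateOrthonormalBasis (finrank_euclideanSpace (𝕜 := ℂ) (ι := n)) hO).reindex
    (Fintype.equivFin n).symm
  have hg : ∀ k, ∃ i : ℂ × ℂ, g k ∈ Module.End.eigenspace (Matrix.toEuclideanLin S) i.2 ⊓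
        Module.End.eigenspace (Matrix.toEuclideanLin T) i.1 := by
    intro k
    refine ⟨(hI.subordinateOrthonormalBasisIndex finrank_euclideanSpace
      (Fintype.equivFin n k) hO).1, ?_⟩
    simp only [g, OrthonormalBasis.reindex_apply]
    exact hI.subordinateOrthonormalBasis_subordinate _ _ hO
  choose e he using hg
  exact ⟨g, fun k => (e k).2, fun k => (e k).1,
    fun k => Module.End.mem_eigenspace_iff.mp (he k).1,
    fun k => Module.End.mem_eigenspace_iff.mp (he k).2⟩

theorem exists_unitary_diagonal_of_commute {S T : Matrix n n ℂ} (hS : S.IsHermitian)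
    (hT : T.IsHermitian) (hST : S * T = T * S) :
    ∃ (W : Matrix n n ℂ) (a b : n → ℝ), Wᴴ * W = 1 ∧
      S * W = W * Matrix.diagonal (fun i => (a i : ℂ)) ∧
      T * W = W * Matrix.diagonal (fun i => (b i : ℂ)) := by
  obtain ⟨g, a, b, h1, h2⟩ := exists_joint_eigenbasis hS hT hST
  have hreal : ∀ {R : Matrix n n ℂ} (hR : R.IsHermitian) (z : ℂ) (k : n),
      Matrix.toEuclideanLin R (g k) = z • g k → ((z.re : ℝ) : ℂ) = z := by
    intro R hR z k h
    have := (Matrix.isSymmetric_toEuclideanLin_iff.mpr hR).conj_eigenvalue_eq_self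
      (Module.End.hasEigenvalue_of_hasEigenvector
        ⟨Module.End.mem_eigenspace_iff.mpr h, g.orthonormal.ne_zero k⟩)
    exact Complex.conj_eq_iff_re.mp this
  have key : ∀ {R : Matrix n n ℂ} (z : n → ℂ),
      (∀ k, Matrix.toEuclideanLin R (g k) = z k • g k) →
      R * Matrix.of (fun i k => g k i) =
        Matrix.of (fun i k => g k i) * Matrix.diagonal z := by
    intro R z h
    ext i k
    have := congrArg (fun v : EuclideanSpace ℂ n => v i) (h k)
    simp only [Matrix.toLpLin_apply, PiLp.smul_apply, smul_eq_mul] at this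
    rw [Matrix.mul_diagonal, Matrix.of_apply, mul_comm, ← this]
    rfl
  refine ⟨Matrix.of fun i k => g k i, fun k => (a k).re, fun k => (b k).re, ?_, ?_, ?_⟩
  · ext i j
    have := orthonormal_iff_ite.mp g.orthonormal i j
    rw [Matrix.one_apply, ← this, PiLp.inner_apply, Matrix.mul_apply]
    exact Finset.sum_congr rfl fun k _ => by simp [mul_comm]
  · simp only [hreal hS _ _ (h1 _)]
    exact key _ h1
  · simp only [hreal hT _ _ (h2 _)]
    exact key _ h2

/-- The overlaps `|⟨u_i, w_k⟩|²` between the columns of two matrices. -/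
def overlap (U W : Matrix n n ℂ) (i k : n) : ℝ := Complex.normSq ((Uᴴ * W) i k)

theorem overlap_nonneg {n : Type*} [Fintype n]
    (U W : Matrix n n ℂ) (i k : n) : 0 ≤ overlap U W i k :=
  Complex.normSq_nonneg _

theorem sum_overlap_right {U W : Matrix n n ℂ} (hU : Uᴴ * U = 1) (hW : Wᴴ * W = 1) (i : n) :
    ∑ k, overlap U W i k = 1 := by
  have h : (Uᴴ * W) * (Uᴴ * W)ᴴ = 1 := by
    rw [Matrix.conjTranspose_mul, Matrix.conjTranspose_conjTranspose, Matrix.mul_assoc,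
      ← Matrix.mul_assoc W, mul_eq_one_comm.mp hW, Matrix.one_mul, hU]
  have h' := congrFun (congrFun h i) i
  rw [Matrix.mul_apply, Matrix.one_apply_eq] at h'
  simp only [Matrix.conjTranspose_apply, Complex.star_def, Complex.mul_conj] at h'
  exact_mod_cast h'

theorem trace_diagonal_mul_diagonal (U W : Matrix n n ℂ) (a b : n → ℂ) :
    (U * Matrix.diagonal a * Uᴴ * (W * Matrix.diagonal b * Wᴴ)).trace =
      ∑ i, ∑ k, a i * b k * (overlap U W i k : ℂ) := by
  have h : (U * Matrix.diagonal a * Uᴴ * (W * Matrix.diagonal b * Wᴴ)).trace =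
      ((Matrix.diagonal a * (Uᴴ * W)) * (Matrix.diagonal b * (Uᴴ * W)ᴴ)).trace := by
    rw [Matrix.conjTranspose_mul, Matrix.conjTranspose_conjTranspose]
    simp only [Matrix.mul_assoc]
    rw [Matrix.trace_mul_comm]
    simp only [Matrix.mul_assoc]
  rw [h, Matrix.trace]
  refine Finset.sum_congr rfl fun i _ => ?_
  rw [Matrix.diag_apply, Matrix.mul_apply]
  refine Finset.sum_congr rfl fun k _ => ?_
  rw [Matrix.diagonal_mul, Matrix.diagonal_mul, Matrix.conjTranspose_apply, overlap,
    ← Complex.mul_conj, Complex.star_def]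
  ring

/-- Functional calculus of a Hermitian matrix. -/
def hermFun {A : Matrix n n ℂ} (hA : A.IsHermitian) (f : ℝ → ℂ) : Matrix n n ℂ :=
  (hA.eigenvectorUnitary : Matrix n n ℂ) * Matrix.diagonal (fun i => f (hA.eigenvalues i)) *
    (hA.eigenvectorUnitary : Matrix n n ℂ)ᴴ

theorem eigenvectorUnitary_conjTranspose_mul {A : Matrix n n ℂ} (hA : A.IsHermitian) :
    (hA.eigenvectorUnitary : Matrix n n ℂ)ᴴ * (hA.eigenvectorUnitary : Matrix n n ℂ) = 1 :=
  Unitary.coe_star_mul_self hA.eigenvectorUnitary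

theorem hermFun_ofReal {A : Matrix n n ℂ} (hA : A.IsHermitian) :
    hermFun hA (fun x => (x : ℂ)) = A := by
  conv_rhs => rw [hA.spectral_theorem]
  rfl

theorem mul_eigenvectorUnitary {A : Matrix n n ℂ} (hA : A.IsHermitian) :
    A * (hA.eigenvectorUnitary : Matrix n n ℂ) =
      (hA.eigenvectorUnitary : Matrix n n ℂ) *
        Matrix.diagonal (fun i => (hA.eigenvalues i : ℂ)) := by
  have h : hermFun hA (fun x => (x : ℂ)) * (hA.eigenvectorUnitary : Matrix n n ℂ) =
      (hA.eigenvectorUnitary : Matrix n n ℂ) *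
        Matrix.diagonal (fun i => (hA.eigenvalues i : ℂ)) := by
    rw [hermFun, Matrix.mul_assoc, eigenvectorUnitary_conjTranspose_mul, Matrix.mul_one]
  rwa [hermFun_ofReal] at h

theorem hermFun_mul {k : Type*} [Fintype k] [DecidableEq k] {A : Matrix n n ℂ}
    (hA : A.IsHermitian) (f : ℝ → ℂ)
    {K : Matrix n k ℂ} {μ : k → ℝ} (h : A * K = K * Matrix.diagonal (fun i => (μ i : ℂ))) :
    hermFun hA f * K = K * Matrix.diagonal (fun i => f (μ i)) := by
  set U : Matrix n n ℂ := (hA.eigenvectorUnitary : Matrix n n ℂ) with hU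
  have hUU : Uᴴ * U = 1 := eigenvectorUnitary_conjTranspose_mul hA
  have h1 : Matrix.diagonal (fun i => (hA.eigenvalues i : ℂ)) * (Uᴴ * K) =
      (Uᴴ * K) * Matrix.diagonal (fun i => (μ i : ℂ)) := by
    rw [Matrix.mul_assoc, ← h]
    conv_rhs => rw [← hermFun_ofReal hA]
    rw [hermFun, ← hU]
    simp only [← Matrix.mul_assoc]
    rw [hUU, Matrix.one_mul]
  have h2 : Matrix.diagonal (fun i => f (hA.eigenvalues i)) * (Uᴴ * K) =
      (Uᴴ * K) * Matrix.diagonal (fun i => f (μ i)) := by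
    ext i j
    have h3 := congrFun (congrFun h1 i) j
    rw [Matrix.diagonal_mul, Matrix.mul_diagonal, mul_comm] at h3 ⊢
    by_cases h0 : (Uᴴ * K) i j = 0
    · rw [h0, zero_mul, zero_mul]
    · rw [Complex.ofReal_inj.mp (mul_left_cancel₀ h0 h3)]
  rw [hermFun, ← hU, Matrix.mul_assoc, Matrix.mul_assoc, h2, ← Matrix.mul_assoc,
    ← Matrix.mul_assoc, mul_eq_one_comm.mp hUU, Matrix.one_mul]

theorem hermFun_comm {A K : Matrix n n ℂ} (hA : A.IsHermitian) (f : ℝ → ℂ)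
    (h : A * K = K * A) : hermFun hA f * K = K * hermFun hA f := by
  have h1 : A * (K * (hA.eigenvectorUnitary : Matrix n n ℂ)) =
      (K * (hA.eigenvectorUnitary : Matrix n n ℂ)) *
        Matrix.diagonal (fun i => (hA.eigenvalues i : ℂ)) := by
    rw [← Matrix.mul_assoc, h, Matrix.mul_assoc, mul_eigenvectorUnitary, Matrix.mul_assoc]
  have h2 := hermFun_mul hA f h1
  have h3 := congrArg (· * (hA.eigenvectorUnitary : Matrix n n ℂ)ᴴ) h2
  simp only [Matrix.mul_assoc] at h3
  rw [mul_eq_one_comm.mp (eigenvectorUnitary_conjTranspose_mul hA), Matrix.mul_one] at h3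
  simpa only [hermFun, Matrix.mul_assoc] using h3

theorem matLog_eq_hermFun {A : Matrix n n ℂ} (hA : A.IsHermitian) :
    matLog A = hermFun hA (fun x => (Real.logb 2 x : ℂ)) := by
  rw [matLog, dif_pos hA, hermFun]
  congr 3
  ext i
  split_ifs with h <;> simp [h]

theorem eq_mul_diagonal_mul_conjTranspose {A W : Matrix n n ℂ} (hW : Wᴴ * W = 1) {μ : n → ℂ}
    (h : A * W = W * Matrix.diagonal μ) : A = W * Matrix.diagonal μ * Wᴴ := by
  rw [← h, Matrix.mul_assoc, mul_eq_one_comm.mp hW, Matrix.mul_one]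

theorem matLog_eq {A W : Matrix n n ℂ} (hA : A.IsHermitian) (hW : Wᴴ * W = 1) {μ : n → ℝ}
    (h : A * W = W * Matrix.diagonal (fun i => (μ i : ℂ))) :
    matLog A = W * Matrix.diagonal (fun i => (Real.logb 2 (μ i) : ℂ)) * Wᴴ := by
  rw [matLog_eq_hermFun hA]
  exact eq_mul_diagonal_mul_conjTranspose hW (hermFun_mul hA _ h)

theorem trace_mul_matLog_sub {ρ σ U W : Matrix n n ℂ} (hρ : ρ.IsHermitian) (hσ : σ.IsHermitian)
    (hU : Uᴴ * U = 1) (hW : Wᴴ * W = 1) {l μ : n → ℝ}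
    (h1 : ρ * U = U * Matrix.diagonal (fun i => (l i : ℂ)))
    (h2 : σ * W = W * Matrix.diagonal (fun i => (μ i : ℂ))) :
    ((ρ * (matLog ρ - matLog σ)).trace).re =
      ∑ i, ∑ k, overlap U W i k * (l i * (Real.logb 2 (l i) - Real.logb 2 (μ k))) := by
  have e1 : (ρ * matLog ρ).trace =
      ∑ i, ∑ k, ((l i : ℂ) * (Real.logb 2 (l i) : ℂ)) * 1 * (overlap U W i k : ℂ) := by
    rw [← trace_diagonal_mul_diagonal U W _ (fun _ => 1), matLog_eq hρ hU h1]
    conv_lhs => rw [eq_mul_diagonal_mul_conjTranspose hU h1]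
    rw [Matrix.diagonal_one, Matrix.mul_one, mul_eq_one_comm.mp hW, Matrix.mul_one,
      ← Matrix.diagonal_mul_diagonal]
    simp only [Matrix.mul_assoc]
    rw [← Matrix.mul_assoc Uᴴ U, hU, Matrix.one_mul]
  have e2 : (ρ * matLog σ).trace =
      ∑ i, ∑ k, (l i : ℂ) * (Real.logb 2 (μ k) : ℂ) * (overlap U W i k : ℂ) := by
    rw [← trace_diagonal_mul_diagonal U W, matLog_eq hσ hW h2,
      ← eq_mul_diagonal_mul_conjTranspose hU h1]
  rw [Matrix.mul_sub, Matrix.trace_sub, e1, e2]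
  have : (∑ i, ∑ k, ((l i : ℂ) * (Real.logb 2 (l i) : ℂ)) * 1 * (overlap U W i k : ℂ)) -
      ∑ i, ∑ k, (l i : ℂ) * (Real.logb 2 (μ k) : ℂ) * (overlap U W i k : ℂ) =
      ((∑ i, ∑ k, overlap U W i k * (l i * (Real.logb 2 (l i) - Real.logb 2 (μ k))) : ℝ) : ℂ) := by
    push_cast
    simp only [← Finset.sum_sub_distrib]
    exact Finset.sum_congr rfl fun i _ => Finset.sum_congr rfl fun k _ => by ring
  rw [this, Complex.ofReal_re]

theorem conjTranspose_mul_eq {ρ U : Matrix n n ℂ} (hU : Uᴴ * U = 1) {l : n → ℂ}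
    (h1 : ρ * U = U * Matrix.diagonal l) : Uᴴ * ρ = Matrix.diagonal l * Uᴴ := by
  conv_lhs => rw [eq_mul_diagonal_mul_conjTranspose hU h1]
  simp only [← Matrix.mul_assoc]
  rw [hU, Matrix.one_mul]

theorem overlap_mul_eq_zero {ρ σ U W : Matrix n n ℂ} (hs : suppLE ρ σ)
    (hU : Uᴴ * U = 1) {l μ : n → ℝ}
    (h1 : ρ * U = U * Matrix.diagonal (fun i => (l i : ℂ)))
    (h2 : σ * W = W * Matrix.diagonal (fun i => (μ i : ℂ))) {i k : n} (hk : μ k = 0) :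
    overlap U W i k * l i = 0 := by
  have h3 : σ.mulVec (fun j => W j k) = 0 := by
    ext j
    have := congrFun (congrFun h2 j) k
    rw [Matrix.mul_diagonal, hk] at this
    simpa [Matrix.mul_apply, Matrix.mulVec, dotProduct] using this
  have h4 := hs _ h3
  have h5 : (Matrix.diagonal (fun i => (l i : ℂ)) * (Uᴴ * W)) i k = 0 := by
    rw [← Matrix.mul_assoc, ← conjTranspose_mul_eq hU h1, Matrix.mul_assoc, Matrix.mul_apply]
    refine Finset.sum_eq_zero fun j _ => ?_
    have : (ρ * W) j k = 0 := congrFun h4 j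
    rw [this, mul_zero]
  rw [Matrix.diagonal_mul] at h5
  rcases mul_eq_zero.mp h5 with h | h
  · rw [Complex.ofReal_eq_zero.mp h, mul_zero]
  · rw [overlap, h, map_zero, zero_mul]

theorem hasDerivAt_mul_log_sub {p q : ℝ} (hp : 0 ≤ p) (hq : 0 ≤ q) (hpq : q = 0 → p = 0)
    {T : ℝ} (hT : 0 ≤ T) :
    HasDerivAt (fun T => p * (Real.log (q + T * p) - Real.log q)) (p ^ 2 / (q + T * p)) T := by
  rcases hp.eq_or_lt with rfl | hp
  · simpa using hasDerivAt_const T (0 : ℝ)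
  · have hq' : 0 < q := lt_of_le_of_ne hq fun h => hp.ne' (hpq h.symm)
    have hs : q + T * p ≠ 0 := by positivity
    have h1 : HasDerivAt (fun T : ℝ => q + T * p) p T := by
      simpa using ((hasDerivAt_id T).mul_const p).const_add q
    have h2 := ((h1.log hs).sub_const (Real.log q)).const_mul p
    rwa [← mul_div_assoc, ← sq] at h2

theorem tendsto_mul_log_sub {p q : ℝ} (hp : 0 ≤ p) (hq : 0 ≤ q) (hpq : q = 0 → p = 0) :
    Filter.Tendsto
      (fun T => p * (Real.log (q + T * p) - Real.log q) - p * Real.log (1 + T))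
      Filter.atTop (nhds (p * (Real.log p - Real.log q))) := by
  rcases hp.eq_or_lt with rfl | hp
  · simp
  · have hq' : 0 < q := lt_of_le_of_ne hq fun h => hp.ne' (hpq h.symm)
    have h1 : Filter.Tendsto (fun T : ℝ => p + (q - p) / (1 + T)) Filter.atTop (nhds p) := by
      have := (tendsto_const_nhds (x := q - p)).div_atTop
        (Filter.tendsto_atTop_add_const_left Filter.atTop (1 : ℝ) Filter.tendsto_id)
      simpa using this.const_add p
    have h2 := ((h1.log hp.ne').sub_const (Real.log q)).const_mul p
    refine h2.congr' ?_
    filter_upwards [Filter.eventually_ge_atTop (0 : ℝ)] with T hT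
    have h3 : p + (q - p) / (1 + T) = (q + T * p) / (1 + T) := by
      field_simp
      ring
    rw [h3, Real.log_div (by positivity) (by positivity)]
    ring

theorem sum_mul_log_sub_le_of_resolvent {ι κ : Type*} [Fintype ι] [Fintype κ]
    {p q : ι → ℝ} {P Q : κ → ℝ} (hp : ∀ x, 0 ≤ p x) (hq : ∀ x, 0 ≤ q x)
    (hpq : ∀ x, q x = 0 → p x = 0) (hP : ∀ x, 0 ≤ P x) (hQ : ∀ x, 0 ≤ Q x)
    (hPQ : ∀ x, Q x = 0 → P x = 0) (hsum : ∑ x, p x = ∑ y, P y)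
    (h : ∀ t : ℝ, 0 < t →
      ∑ x, p x ^ 2 / (q x + t * p x) ≤ ∑ y, P y ^ 2 / (Q y + t * P y)) :
    ∑ x, p x * (Real.log (p x) - Real.log (q x)) ≤
      ∑ y, P y * (Real.log (P y) - Real.log (Q y)) := by
  let G : ℝ → ℝ := fun T => ∑ y, P y * (Real.log (Q y + T * P y) - Real.log (Q y)) -
    ∑ x, p x * (Real.log (q x + T * p x) - Real.log (q x))
  have hd : ∀ T : ℝ, 0 ≤ T → HasDerivAt G
      (∑ y, P y ^ 2 / (Q y + T * P y) - ∑ x, p x ^ 2 / (q x + T * p x)) T := fun T hT =>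
    (HasDerivAt.fun_sum fun y _ => hasDerivAt_mul_log_sub (hP y) (hQ y) (hPQ y) hT).sub
      (HasDerivAt.fun_sum fun x _ => hasDerivAt_mul_log_sub (hp x) (hq x) (hpq x) hT)
  have hmono : MonotoneOn G (Set.Ici 0) := by
    refine monotoneOn_of_deriv_nonneg (convex_Ici 0)
      (fun T hT => (hd T hT).continuousAt.continuousWithinAt) ?_ ?_
    · rw [interior_Ici]
      exact fun T hT => (hd T (le_of_lt hT)).differentiableAt.differentiableWithinAt
    · rw [interior_Ici]
      intro T hT
      rw [(hd T (le_of_lt hT)).deriv]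
      exact sub_nonneg.mpr (h T hT)
  have hG0 : G 0 = 0 := by simp [G]
  have hlim : Filter.Tendsto G Filter.atTop
      (nhds (∑ y, P y * (Real.log (P y) - Real.log (Q y)) -
        ∑ x, p x * (Real.log (p x) - Real.log (q x)))) := by
    refine ((tendsto_finsetSum Finset.univ fun y _ =>
      tendsto_mul_log_sub (hP y) (hQ y) (hPQ y)).sub
      (tendsto_finsetSum Finset.univ fun x _ =>
        tendsto_mul_log_sub (hp x) (hq x) (hpq x))).congr fun T => ?_
    simp only [Finset.sum_sub_distrib, ← Finset.sum_mul, hsum, G]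
    ring
  have := ge_of_tendsto hlim (b := 0) (by
    filter_upwards [Filter.eventually_ge_atTop (0 : ℝ)] with T hT
    rw [← hG0]
    exact hmono Set.self_mem_Ici hT hT)
  linarith

open scoped MatrixOrder in
theorem exists_eq_conjTranspose_mul_self {n : Type*} [Fintype n]
    {A : Matrix n n ℂ} (hA : A.PosSemidef) :
    ∃ B : Matrix n n ℂ, A = Bᴴ * B :=
  CStarAlgebra.nonneg_iff_eq_star_mul_self.mp hA.nonneg

theorem trace_mul_re_nonneg {n : Type*} [Fintype n]
    {A B : Matrix n n ℂ} (hA : A.PosSemidef) (hB : B.PosSemidef) :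
    0 ≤ ((A * B).trace).re := by
  obtain ⟨C, rfl⟩ := exists_eq_conjTranspose_mul_self hB
  rw [← Matrix.mul_assoc, Matrix.trace_mul_comm, ← Matrix.mul_assoc]
  exact (Complex.le_def.mp (hA.mul_mul_conjTranspose_same C).trace_nonneg).1

theorem eigenvalue_nonneg_of_mul_eq {A W : Matrix n n ℂ} (hA : A.PosSemidef) (hW : Wᴴ * W = 1)
    {μ : n → ℝ} (h : A * W = W * Matrix.diagonal (fun i => (μ i : ℂ))) (i : n) : 0 ≤ μ i := by
  have h1 := hA.conjTranspose_mul_mul_same W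
  rw [Matrix.mul_assoc, h, ← Matrix.mul_assoc, hW, Matrix.one_mul] at h1
  have := h1.diag_nonneg (i := i)
  rw [Matrix.diagonal_apply_eq] at this
  exact_mod_cast this

theorem two_mul_trace_sub_le {ρ σ U W X : Matrix n n ℂ} (hX : X.IsHermitian)
    (hU : Uᴴ * U = 1) (hW : Wᴴ * W = 1) {l μ : n → ℝ} (hl : ∀ i, 0 ≤ l i) (hμ : ∀ i, 0 ≤ μ i)
    (h1 : ρ * U = U * Matrix.diagonal (fun i => (l i : ℂ)))
    (h2 : σ * W = W * Matrix.diagonal (fun i => (μ i : ℂ))) {t : ℝ} (ht : 0 < t) :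
    2 * ((X * ρ).trace).re - ((X * X * σ).trace).re - t * ((X * X * ρ).trace).re ≤
      ∑ i, ∑ k, (overlap U W i k * l i) ^ 2 /
        (overlap U W i k * μ k + t * (overlap U W i k * l i)) := by
  have hUU := mul_eq_one_comm.mp hU
  have hWW := mul_eq_one_comm.mp hW
  set Y := Uᴴ * X * W with hY
  have hYc : Yᴴ = Wᴴ * X * U := by
    rw [hY, Matrix.conjTranspose_mul, Matrix.conjTranspose_mul, Matrix.conjTranspose_conjTranspose,
      hX.eq, Matrix.mul_assoc]
  have e1 : (X * ρ).trace =
      ((∑ i, ∑ k, l i * (Y i k * star ((Uᴴ * W) i k)).re : ℝ) : ℂ) +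
        ((∑ i, ∑ k, l i * (Y i k * star ((Uᴴ * W) i k)).im : ℝ) : ℂ) * Complex.I := by
    have : (X * ρ).trace = (Matrix.diagonal (fun i => (l i : ℂ)) * (Y * (Uᴴ * W)ᴴ)).trace := by
      rw [Matrix.conjTranspose_mul, Matrix.conjTranspose_conjTranspose, hY,
        Matrix.mul_assoc (Uᴴ * X) W, ← Matrix.mul_assoc W, hWW, Matrix.one_mul]
      simp only [← Matrix.mul_assoc]
      rw [← conjTranspose_mul_eq hU h1]
      conv_rhs => rw [Matrix.trace_mul_comm]
      simp only [← Matrix.mul_assoc]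
      rw [hUU, Matrix.one_mul, Matrix.trace_mul_comm]
    rw [this, Matrix.trace]
    push_cast
    rw [Finset.sum_mul, ← Finset.sum_add_distrib]
    refine Finset.sum_congr rfl fun i _ => ?_
    rw [Matrix.diag_apply, Matrix.diagonal_mul, Matrix.mul_apply, Finset.mul_sum, Finset.sum_mul,
      ← Finset.sum_add_distrib]
    refine Finset.sum_congr rfl fun k _ => ?_
    rw [Matrix.conjTranspose_apply]
    conv_lhs => rw [← Complex.re_add_im (Y i k * star ((Uᴴ * W) i k))]
    ring
  have e2 : (X * X * σ).trace = ((∑ i, ∑ k, μ k * Complex.normSq (Y i k) : ℝ) : ℂ) := by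
    have : (X * X * σ).trace = (Matrix.diagonal (fun i => (μ i : ℂ)) * (Yᴴ * Y)).trace := by
      rw [hYc, hY]
      have : Wᴴ * X * U * (Uᴴ * X * W) = Wᴴ * (X * X * W) := by
        simp only [Matrix.mul_assoc]
        rw [← Matrix.mul_assoc U, hUU, Matrix.one_mul]
      rw [this, ← Matrix.mul_assoc, ← conjTranspose_mul_eq hW h2]
      conv_rhs => rw [Matrix.trace_mul_comm]
      simp only [← Matrix.mul_assoc]
      rw [Matrix.mul_assoc (X * X), hWW, Matrix.mul_one]
    rw [this, Matrix.trace, Finset.sum_comm]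
    push_cast
    refine Finset.sum_congr rfl fun k _ => ?_
    rw [Matrix.diag_apply, Matrix.diagonal_mul, Matrix.mul_apply, Finset.mul_sum]
    refine Finset.sum_congr rfl fun i _ => ?_
    rw [Matrix.conjTranspose_apply, ← Complex.mul_conj, Complex.star_def]
    ring
  have e3 : (X * X * ρ).trace = ((∑ i, ∑ k, l i * Complex.normSq (Y i k) : ℝ) : ℂ) := by
    have : (X * X * ρ).trace = (Matrix.diagonal (fun i => (l i : ℂ)) * (Y * Yᴴ)).trace := by
      rw [hYc, hY]
      have : Uᴴ * X * W * (Wᴴ * X * U) = Uᴴ * (X * X * U) := by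
        simp only [Matrix.mul_assoc]
        rw [← Matrix.mul_assoc W, hWW, Matrix.one_mul]
      rw [this, ← Matrix.mul_assoc, ← conjTranspose_mul_eq hU h1]
      conv_rhs => rw [Matrix.trace_mul_comm]
      simp only [← Matrix.mul_assoc]
      rw [Matrix.mul_assoc (X * X), hUU, Matrix.mul_one]
    rw [this, Matrix.trace]
    push_cast
    refine Finset.sum_congr rfl fun i _ => ?_
    rw [Matrix.diag_apply, Matrix.diagonal_mul, Matrix.mul_apply, Finset.mul_sum]
    refine Finset.sum_congr rfl fun k _ => ?_
    rw [Matrix.conjTranspose_apply, ← Complex.mul_conj, Complex.star_def]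
  rw [e2, e3, e1, Complex.ofReal_re, Complex.ofReal_re, Complex.add_re, Complex.ofReal_re,
    Complex.re_ofReal_mul, Complex.I_re, mul_zero, add_zero]
  simp only [Finset.mul_sum, ← Finset.sum_sub_distrib]
  refine Finset.sum_le_sum fun i _ => Finset.sum_le_sum fun k _ => ?_
  rw [overlap]
  generalize (Uᴴ * W) i k = o
  generalize Y i k = y
  have hli := hl i
  have hμk := hμ k
  simp only [Complex.star_def, Complex.mul_re, Complex.conj_re, Complex.conj_im,
    Complex.normSq_apply]
  rcases (add_nonneg hμk (mul_nonneg ht.le hli)).eq_or_lt with h0 | h0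
  · have hl0 : l i = 0 := by nlinarith [mul_nonneg ht.le hli]
    have hμ0 : μ k = 0 := by rw [hl0] at h0; linarith
    simp [hl0, hμ0]
  · rcases (Complex.normSq_nonneg o).eq_or_lt with ho | ho
    · have ho' : o = 0 := Complex.normSq_eq_zero.mp ho.symm
      subst ho'
      simp
      nlinarith [mul_self_nonneg y.re, mul_self_nonneg y.im]
    · rw [Complex.normSq_apply] at ho
      rw [le_div_iff₀ (by nlinarith [mul_pos ho h0])]
      nlinarith [mul_nonneg ho.le (add_nonneg
        (mul_self_nonneg (o.re * l i - (μ k + t * l i) * y.re))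
        (mul_self_nonneg (o.im * l i - (μ k + t * l i) * y.im)))]

theorem sum_sq_div_le {ρ σ U W : Matrix n n ℂ} (hρ : ρ.PosSemidef) (hσ : σ.PosSemidef)
    (hU : Uᴴ * U = 1) (hW : Wᴴ * W = 1) {l μ : n → ℝ}
    (h1 : ρ * U = U * Matrix.diagonal (fun i => (l i : ℂ)))
    (h2 : σ * W = W * Matrix.diagonal (fun i => (μ i : ℂ))) {m : ℕ}
    {M : Fin m → Matrix n n ℂ} (hM : IsPOVM M) {t : ℝ} (ht : 0 < t) :
    ∑ x, ((M x * ρ).trace).re ^ 2 / (((M x * σ).trace).re + t * ((M x * ρ).trace).re) ≤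
      ∑ i, ∑ k, (overlap U W i k * l i) ^ 2 /
        (overlap U W i k * μ k + t * (overlap U W i k * l i)) := by
  set p : Fin m → ℝ := fun x => ((M x * ρ).trace).re with hp
  set q : Fin m → ℝ := fun x => ((M x * σ).trace).re with hq
  have hp0 : ∀ x, 0 ≤ p x := fun x => trace_mul_re_nonneg (hM.1 x) hρ
  have hq0 : ∀ x, 0 ≤ q x := fun x => trace_mul_re_nonneg (hM.1 x) hσ
  let c : Fin m → ℝ := fun x => p x / (q x + t * p x)
  let X : Matrix n n ℂ := ∑ x, (c x : ℂ) • M x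
  have hX : X.IsHermitian := by
    simp only [X, Matrix.IsHermitian, Matrix.conjTranspose_sum, Matrix.conjTranspose_smul,
      (hM.1 _).1.eq, Complex.star_def, Complex.conj_ofReal]
  have hpsd : (∑ x, ((c x : ℂ) ^ 2) • M x - X * X).PosSemidef := by
    have h3 : (∑ x, ((c x : ℂ) • (1 : Matrix n n ℂ) - X)ᴴ * M x *
        ((c x : ℂ) • (1 : Matrix n n ℂ) - X)).PosSemidef :=
      Matrix.posSemidef_sum _ fun x _ => (hM.1 x).conjTranspose_mul_mul_same _
    have h4 : ∀ x, ((c x : ℂ) • (1 : Matrix n n ℂ) - X)ᴴ * M x *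
        ((c x : ℂ) • (1 : Matrix n n ℂ) - X) =
        ((c x : ℂ) ^ 2) • M x - ((c x : ℂ) • M x) * X - X * ((c x : ℂ) • M x) + X * M x * X := by
      intro x
      rw [Matrix.conjTranspose_sub, Matrix.conjTranspose_smul, Matrix.conjTranspose_one, hX.eq,
        Complex.star_def, Complex.conj_ofReal]
      simp only [sub_mul, mul_sub, smul_mul_assoc, mul_smul_comm, one_mul, mul_one, smul_smul, sq,
        smul_sub]
      abel
    simp only [h4, Finset.sum_add_distrib, Finset.sum_sub_distrib, ← Finset.sum_mul,
      ← Finset.mul_sum, hM.2, mul_one] at h3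
    convert h3 using 1
    simp only [X]
    abel
  have key : ∀ τ : Matrix n n ℂ, τ.PosSemidef →
      ((X * X * τ).trace).re ≤ ∑ x, c x ^ 2 * ((M x * τ).trace).re := by
    intro τ hτ
    have := trace_mul_re_nonneg hpsd hτ
    rw [sub_mul, Matrix.trace_sub, Finset.sum_mul, Matrix.trace_sum, Complex.sub_re,
      Complex.re_sum] at this
    have h5 : ∀ x, (((((c x : ℂ) ^ 2) • M x) * τ).trace).re = c x ^ 2 * ((M x * τ).trace).re := by
      intro x
      rw [smul_mul_assoc, Matrix.trace_smul, smul_eq_mul, ← Complex.ofReal_pow,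
        Complex.re_ofReal_mul]
    simp only [h5] at this
    linarith
  have hXρ : ((X * ρ).trace).re = ∑ x, c x * p x := by
    simp only [X, Finset.sum_mul, Matrix.trace_sum, Complex.re_sum, smul_mul_assoc,
      Matrix.trace_smul, smul_eq_mul, Complex.re_ofReal_mul, hp]
  refine le_trans ?_ (two_mul_trace_sub_le hX hU hW (eigenvalue_nonneg_of_mul_eq hρ hU h1)
    (eigenvalue_nonneg_of_mul_eq hσ hW h2) h1 h2 ht)
  have k1 := key σ hσ
  have k2 := mul_le_mul_of_nonneg_left (key ρ hρ) ht.le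
  have k3 : ∑ x, p x ^ 2 / (q x + t * p x) =
      2 * ∑ x, c x * p x - ∑ x, c x ^ 2 * q x - t * ∑ x, c x ^ 2 * p x := by
    simp only [Finset.mul_sum, ← Finset.sum_sub_distrib]
    refine Finset.sum_congr rfl fun x _ => ?_
    simp only [c]
    have hpx := hp0 x
    have hqx := hq0 x
    rcases (add_nonneg hqx (mul_nonneg ht.le hpx)).eq_or_lt with h0 | h0
    · rw [← h0]; simp
    · obtain ⟨s, hs⟩ : ∃ s, s = q x + t * p x := ⟨_, rfl⟩
      rw [← hs] at h0 ⊢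
      rw [eq_sub_of_add_eq hs.symm]
      field_simp
      ring
  rw [k3, hXρ]
  linarith

theorem klTerm_eq {p q : ℝ} (h : q = 0 → p = 0) :
    klTerm p q = ((p * (Real.logb 2 p - Real.logb 2 q) : ℝ) : EReal) := by
  unfold klTerm
  split_ifs with h1 h2
  · simp [h1]
  · exact absurd (h h2) h1
  · rw [Real.logb_div h1 h2]

theorem coe_sum_ereal {ι : Type*} (s : Finset ι) (f : ι → ℝ) :
    ((∑ i ∈ s, f i : ℝ) : EReal) = ∑ i ∈ s, (f i : EReal) := by
  induction s using Finset.cons_induction with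
  | empty => simp
  | cons a s ha ih => rw [Finset.sum_cons, Finset.sum_cons, EReal.coe_add, ih]

theorem trace_mul_re_eq_zero_of_suppLE {n : Type*} [Fintype n]
    {ρ σ M : Matrix n n ℂ} (hσ : σ.PosSemidef)
    (hM : M.PosSemidef) (hs : suppLE ρ σ) (h : ((M * σ).trace).re = 0) :
    ((M * ρ).trace).re = 0 := by
  obtain ⟨B, rfl⟩ := exists_eq_conjTranspose_mul_self hM
  obtain ⟨C, rfl⟩ := exists_eq_conjTranspose_mul_self hσ
  have e : (Bᴴ * B * (Cᴴ * C)).trace = ((C * Bᴴ)ᴴ * (C * Bᴴ)).trace := by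
    rw [Matrix.conjTranspose_mul, Matrix.conjTranspose_conjTranspose]
    simp only [Matrix.mul_assoc]
    rw [Matrix.trace_mul_comm]
    simp only [Matrix.mul_assoc]
  have h0 : ((C * Bᴴ)ᴴ * (C * Bᴴ)).trace = 0 := by
    have h1 := Complex.le_def.mp (Matrix.posSemidef_conjTranspose_mul_self (C * Bᴴ)).trace_nonneg
    rw [e] at h
    exact Complex.ext h h1.2.symm
  have h2 : C * Bᴴ = 0 := Matrix.trace_conjTranspose_mul_self_eq_zero_iff.mp h0
  have h3 : ρ * Bᴴ = 0 := by
    ext i j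
    have h4 : (Cᴴ * C).mulVec (fun k => Bᴴ k j) = 0 := by
      have : Cᴴ * C * Bᴴ = 0 := by rw [Matrix.mul_assoc, h2, Matrix.mul_zero]
      ext i
      exact congrFun (congrFun this i) j
    exact congrFun (hs _ h4) i
  rw [Matrix.mul_assoc, Matrix.trace_mul_comm, Matrix.mul_assoc, h3, Matrix.mul_zero,
    Matrix.trace_zero, Complex.zero_re]

theorem measRelEnt_le_relEnt {ρ σ : Matrix n n ℂ} (hρ : ρ.PosSemidef) (hσ : σ.PosSemidef) :
    measRelEnt ρ σ ≤ relEnt ρ σ := by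
  unfold relEnt
  split_ifs with hs
  swap
  · exact le_top
  have hU := eigenvectorUnitary_conjTranspose_mul hρ.1
  have hW := eigenvectorUnitary_conjTranspose_mul hσ.1
  have h1 := mul_eigenvectorUnitary hρ.1
  have h2 := mul_eigenvectorUnitary hσ.1
  set U : Matrix n n ℂ := (hρ.1.eigenvectorUnitary : Matrix n n ℂ)
  set W : Matrix n n ℂ := (hσ.1.eigenvectorUnitary : Matrix n n ℂ)
  set l := hρ.1.eigenvalues
  set μ := hσ.1.eigenvalues
  have hl : ∀ i, 0 ≤ l i := hρ.eigenvalues_nonneg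
  have hμ : ∀ i, 0 ≤ μ i := hσ.eigenvalues_nonneg
  rw [trace_mul_matLog_sub hρ.1 hσ.1 hU hW h1 h2]
  refine iSup_le fun m => iSup_le fun M => iSup_le fun hM => ?_
  have hpq : ∀ x, ((M x * σ).trace).re = 0 → ((M x * ρ).trace).re = 0 := fun x =>
    trace_mul_re_eq_zero_of_suppLE hσ (hM.1 x) hs
  simp only [fun x => klTerm_eq (hpq x)]
  rw [← coe_sum_ereal, EReal.coe_le_coe_iff]
  have hsum : ∑ x, ((M x * ρ).trace).re = ∑ y : n × n, overlap U W y.1 y.2 * l y.1 := by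
    rw [← Complex.re_sum, ← Matrix.trace_sum, ← Finset.sum_mul, hM.2, Matrix.one_mul,
      Fintype.sum_prod_type]
    simp only [← Finset.sum_mul, sum_overlap_right hU hW, one_mul]
    rw [hρ.1.trace_eq_sum_eigenvalues, Complex.re_sum]
    rfl
  have h3 := sum_mul_log_sub_le_of_resolvent
    (p := fun x => ((M x * ρ).trace).re) (q := fun x => ((M x * σ).trace).re)
    (P := fun y : n × n => overlap U W y.1 y.2 * l y.1)
    (Q := fun y : n × n => overlap U W y.1 y.2 * μ y.2)
    (fun x => trace_mul_re_nonneg (hM.1 x) hρ) (fun x => trace_mul_re_nonneg (hM.1 x) hσ) hpq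
    (fun y => mul_nonneg (overlap_nonneg _ _ _ _) (hl _))
    (fun y => mul_nonneg (overlap_nonneg _ _ _ _) (hμ _))
    (fun y hy => by
      rcases mul_eq_zero.mp hy with h | h
      · rw [h, zero_mul]
      · exact overlap_mul_eq_zero hs hU h1 h2 h)
    hsum
    (fun t ht => by
      rw [Fintype.sum_prod_type]
      exact sum_sq_div_le hρ hσ hU hW h1 h2 hM ht)
  rw [Fintype.sum_prod_type] at h3
  have h4 : ∀ i k, overlap U W i k * (l i * (Real.logb 2 (l i) - Real.logb 2 (μ k))) =
      overlap U W i k * l i * (Real.log (overlap U W i k * l i) -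
        Real.log (overlap U W i k * μ k)) / Real.log 2 := by
    intro i k
    by_cases ho : overlap U W i k = 0
    · simp [ho]
    by_cases hl0 : l i = 0
    · simp [hl0]
    by_cases hμ0 : μ k = 0
    · exact absurd (overlap_mul_eq_zero hs hU h1 h2 hμ0) (mul_ne_zero ho hl0)
    rw [Real.log_mul ho hl0, Real.log_mul ho hμ0, Real.logb, Real.logb]
    ring
  simp only [h4, ← Finset.sum_div]
  rw [le_div_iff₀ (Real.log_pos one_lt_two), Finset.sum_mul]
  refine le_trans (le_of_eq ?_) h3
  refine Finset.sum_congr rfl fun x _ => ?_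
  rw [Real.logb, Real.logb, ← sub_div, mul_div_assoc', div_mul_cancel₀]
  exact (Real.log_pos one_lt_two).ne'

/-- The distinct eigenvalues of a Hermitian matrix. -/
def spec {A : Matrix n n ℂ} (hA : A.IsHermitian) : Finset ℝ :=
  Finset.univ.image hA.eigenvalues

/-- The spectral projection of a Hermitian matrix at a real number. -/
def specProj {A : Matrix n n ℂ} (hA : A.IsHermitian) (a : ℝ) : Matrix n n ℂ :=
  hermFun hA (fun x => if x = a then 1 else 0)

theorem specProj_isHermitian {A : Matrix n n ℂ} (hA : A.IsHermitian) (a : ℝ) :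
    (specProj hA a).IsHermitian := by
  rw [specProj, hermFun, Matrix.IsHermitian, Matrix.conjTranspose_mul, Matrix.conjTranspose_mul,
    Matrix.conjTranspose_conjTranspose, Matrix.diagonal_conjTranspose, Matrix.mul_assoc]
  congr 3
  ext i
  simp only [Pi.star_apply]
  split_ifs <;> simp

theorem sum_specProj {A : Matrix n n ℂ} (hA : A.IsHermitian) :
    ∑ a ∈ spec hA, specProj hA a = 1 := by
  simp only [specProj, hermFun]
  rw [← Finset.sum_mul, ← Finset.mul_sum]
  have : ∑ a ∈ spec hA, Matrix.diagonal (fun i => if hA.eigenvalues i = a then (1 : ℂ) else 0) =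
      1 := by
    ext i j
    rw [Matrix.sum_apply]
    by_cases h : i = j
    · subst h
      simp [spec]
    · simp [h]
  rw [this, Matrix.mul_one, mul_eq_one_comm.mp (eigenvectorUnitary_conjTranspose_mul hA)]

/-- The pinching of `ρ` with respect to the spectral projections of `A`. -/
def pinch {A : Matrix n n ℂ} (hA : A.IsHermitian) (ρ : Matrix n n ℂ) : Matrix n n ℂ :=
  ∑ a ∈ spec hA, specProj hA a * ρ * specProj hA a

theorem pinch_isHermitian {A ρ : Matrix n n ℂ} (hA : A.IsHermitian) (hρ : ρ.IsHermitian) :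
    (pinch hA ρ).IsHermitian := by
  simp only [pinch, Matrix.IsHermitian, Matrix.conjTranspose_sum, Matrix.conjTranspose_mul,
    (specProj_isHermitian hA _).eq, hρ.eq, Matrix.mul_assoc]

theorem specProj_comm_self {A : Matrix n n ℂ} (hA : A.IsHermitian) (a : ℝ) :
    specProj hA a * A = A * specProj hA a := hermFun_comm hA _ rfl

theorem mul_specProj {A : Matrix n n ℂ} (hA : A.IsHermitian) (a : ℝ) :
    A * specProj hA a = (a : ℂ) • specProj hA a := by
  rw [specProj, hermFun, ← Matrix.mul_assoc, ← Matrix.mul_assoc, mul_eigenvectorUnitary,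
    Matrix.mul_assoc _ (Matrix.diagonal _) (Matrix.diagonal _), Matrix.diagonal_mul_diagonal,
    ← smul_mul_assoc, ← mul_smul_comm, ← Matrix.diagonal_smul]
  congr 3
  ext i
  simp only [Pi.smul_apply, smul_eq_mul]
  split_ifs with h <;> simp [h]

theorem mul_pinch {A ρ : Matrix n n ℂ} (hA : A.IsHermitian) :
    A * pinch hA ρ = pinch hA ρ * A := by
  rw [pinch, Finset.mul_sum, Finset.sum_mul]
  refine Finset.sum_congr rfl fun a _ => ?_
  rw [Matrix.mul_assoc _ _ A, specProj_comm_self, ← Matrix.mul_assoc, ← Matrix.mul_assoc,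
    mul_specProj, mul_smul_comm, smul_mul_assoc, smul_mul_assoc]

/-- The pinching inequality, up to a factor equal to the number of distinct eigenvalues. -/
theorem pinching_inequality {A ρ : Matrix n n ℂ} (hA : A.IsHermitian) (hρ : ρ.PosSemidef) :
    (((spec hA).card : ℂ) • (((spec hA).card : ℂ) • pinch hA ρ - ρ)).PosSemidef := by
  obtain ⟨B, rfl⟩ := exists_eq_conjTranspose_mul_self hρ
  have h : (∑ a ∈ spec hA, (((spec hA).card : ℂ) • (B * specProj hA a) - B)ᴴ *
      (((spec hA).card : ℂ) • (B * specProj hA a) - B)).PosSemidef :=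
    Matrix.posSemidef_sum _ fun a _ => Matrix.posSemidef_conjTranspose_mul_self _
  have e : ∀ a, (((spec hA).card : ℂ) • (B * specProj hA a) - B)ᴴ *
      (((spec hA).card : ℂ) • (B * specProj hA a) - B) =
      (((spec hA).card : ℂ) * ((spec hA).card : ℂ)) • (specProj hA a * (Bᴴ * B) * specProj hA a)
        - ((spec hA).card : ℂ) • (specProj hA a * (Bᴴ * B))
        - ((spec hA).card : ℂ) • ((Bᴴ * B) * specProj hA a) + Bᴴ * B := by
    intro a
    rw [Matrix.conjTranspose_sub, Matrix.conjTranspose_smul, Matrix.conjTranspose_mul,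
      (specProj_isHermitian hA a).eq]
    simp only [sub_mul, mul_sub, smul_mul_assoc, mul_smul_comm, smul_smul, Matrix.mul_assoc,
      star_natCast, smul_sub]
    abel
  simp only [e, Finset.sum_add_distrib, Finset.sum_sub_distrib, ← Finset.smul_sum,
    ← Finset.sum_mul, ← Finset.mul_sum, sum_specProj, Finset.sum_const, mul_one, one_mul] at h
  convert h using 1
  rw [pinch, smul_sub, smul_smul, ← Nat.cast_smul_eq_nsmul ℂ, smul_mul_assoc]
  abel

theorem conjTranspose_mul_pinch_mul_diag {A ρ W : Matrix n n ℂ} (hA : A.IsHermitian)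
    (hW : Wᴴ * W = 1) {a : n → ℝ} (h : A * W = W * Matrix.diagonal (fun i => (a i : ℂ))) (k : n) :
    (Wᴴ * pinch hA ρ * W) k k = (Wᴴ * ρ * W) k k := by
  have h1 : ∀ x, specProj hA x * W =
      W * Matrix.diagonal (fun i => if a i = x then (1 : ℂ) else 0) := fun x => hermFun_mul hA _ h
  have h2 : ∀ x, Wᴴ * specProj hA x =
      Matrix.diagonal (fun i => if a i = x then (1 : ℂ) else 0) * Wᴴ := fun x =>
    conjTranspose_mul_eq hW (h1 x)
  have h3 : ∑ x ∈ spec hA, (if a k = x then (1 : ℂ) else 0) = 1 := by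
    have h4 : Wᴴ * (∑ x ∈ spec hA, specProj hA x) * W = 1 := by
      rw [sum_specProj, Matrix.mul_one, hW]
    simp only [Finset.mul_sum, Finset.sum_mul, h2, Matrix.mul_assoc, hW, Matrix.mul_one] at h4
    have h5 := congrFun (congrFun h4 k) k
    rw [Matrix.sum_apply] at h5
    simpa using h5
  have h6 : ∀ x, (Wᴴ * (specProj hA x * ρ * specProj hA x) * W) k k =
      (if a k = x then (1 : ℂ) else 0) * (Wᴴ * ρ * W) k k := by
    intro x
    have : Wᴴ * (specProj hA x * ρ * specProj hA x) * W =
        (Wᴴ * specProj hA x) * ρ * (specProj hA x * W) := by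
      simp only [Matrix.mul_assoc]
    rw [this, h1, h2]
    have : Matrix.diagonal (fun i => if a i = x then (1 : ℂ) else 0) * Wᴴ * ρ *
        (W * Matrix.diagonal (fun i => if a i = x then (1 : ℂ) else 0)) =
        Matrix.diagonal (fun i => if a i = x then (1 : ℂ) else 0) * (Wᴴ * ρ * W) *
        Matrix.diagonal (fun i => if a i = x then (1 : ℂ) else 0) := by
      simp only [Matrix.mul_assoc]
    rw [this, Matrix.mul_diagonal, Matrix.diagonal_mul]
    split_ifs <;> simp
  rw [pinch, Finset.mul_sum, Finset.sum_mul, Matrix.sum_apply, Finset.sum_congr rfl fun x _ => h6 x,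
    ← Finset.sum_mul, h3, one_mul]

theorem measure_basis_psd (W : Matrix n n ℂ) (k : n) :
    (W * Matrix.single k k 1 * Wᴴ).PosSemidef := by
  refine Matrix.PosSemidef.mul_mul_conjTranspose_same ?_ W
  rw [← Matrix.diagonal_single]
  exact Matrix.PosSemidef.diagonal (Pi.single_nonneg.mpr zero_le_one)

theorem sum_measure_basis {W : Matrix n n ℂ} (hW : Wᴴ * W = 1) :
    ∑ k, W * Matrix.single k k 1 * Wᴴ = 1 := by
  rw [← Finset.sum_mul, ← Finset.mul_sum]
  have : ∑ k : n, Matrix.single k k (1 : ℂ) = 1 := by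
    ext i j
    rw [Matrix.sum_apply]
    by_cases h : i = j
    · subst h; simp [Matrix.single_apply]
    · simp [Matrix.single_apply, h]
  rw [this, Matrix.mul_one, mul_eq_one_comm.mp hW]

theorem trace_measure_basis (W ρ : Matrix n n ℂ) (k : n) :
    (W * Matrix.single k k 1 * Wᴴ * ρ).trace = (Wᴴ * ρ * W) k k := by
  rw [Matrix.mul_assoc, Matrix.mul_assoc, Matrix.trace_mul_comm, Matrix.mul_assoc,
    Matrix.trace_single_mul]
  simp [Matrix.mul_assoc]

theorem diag_eq_sum_overlap {ρ U W : Matrix n n ℂ} (hU : Uᴴ * U = 1) {l : n → ℝ}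
    (h1 : ρ * U = U * Matrix.diagonal (fun i => (l i : ℂ))) (k : n) :
    (Wᴴ * ρ * W) k k = ((∑ i, overlap U W i k * l i : ℝ) : ℂ) := by
  have : Wᴴ * ρ * W = (Uᴴ * W)ᴴ * (Matrix.diagonal (fun i => (l i : ℂ)) * (Uᴴ * W)) := by
    conv_lhs => rw [eq_mul_diagonal_mul_conjTranspose hU h1]
    rw [Matrix.conjTranspose_mul, Matrix.conjTranspose_conjTranspose]
    simp only [Matrix.mul_assoc]
  rw [this, Matrix.mul_apply]
  push_cast
  refine Finset.sum_congr rfl fun i _ => ?_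
  rw [Matrix.conjTranspose_apply, Matrix.diagonal_mul, overlap, ← Complex.mul_conj,
    Complex.star_def]
  ring

theorem sum_overlap_div_le {ρ U W : Matrix n n ℂ} (hU : Uᴴ * U = 1)
    {l b : n → ℝ} (hl : ∀ i, 0 ≤ l i) (hb : ∀ k, 0 ≤ b k)
    (h1 : ρ * U = U * Matrix.diagonal (fun i => (l i : ℂ))) {v : ℝ} (hv0 : 0 ≤ v)
    (hv : ((v : ℂ) • Matrix.diagonal (fun k => (b k : ℂ)) - Wᴴ * ρ * W).PosSemidef) (i : n) :
    l i * ∑ k, overlap U W i k / b k ≤ v := by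
  set s : ℝ := ∑ k, overlap U W i k / b k with hs
  have hs0 : 0 ≤ s := Finset.sum_nonneg fun k _ => div_nonneg (overlap_nonneg _ _ _ _) (hb k)
  set O := Uᴴ * W with hO
  let y : n → ℂ := fun k => star (O i k) / b k
  have e0 : Wᴴ * ρ * W = Oᴴ * (Matrix.diagonal (fun i => (l i : ℂ)) * O) := by
    conv_lhs => rw [eq_mul_diagonal_mul_conjTranspose hU h1]
    rw [hO, Matrix.conjTranspose_mul, Matrix.conjTranspose_conjTranspose]
    simp only [Matrix.mul_assoc]
  have hy := hv.re_dotProduct_nonneg y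
  rw [Matrix.sub_mulVec, dotProduct_sub, map_sub, sub_nonneg] at hy
  have e1 : RCLike.re (star y ⬝ᵥ
      (((v : ℂ) • Matrix.diagonal (fun k => (b k : ℂ))).mulVec y)) = v * s := by
    have : star y ⬝ᵥ (((v : ℂ) • Matrix.diagonal (fun k => (b k : ℂ))).mulVec y) =
        ((v * s : ℝ) : ℂ) := by
      rw [Matrix.smul_mulVec, dotProduct_smul, dotProduct, hs]
      push_cast
      rw [smul_eq_mul]
      congr 1
      refine Finset.sum_congr rfl fun k _ => ?_
      rw [Matrix.mulVec_diagonal, overlap, ← hO, ← Complex.mul_conj]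
      simp only [y, Pi.star_apply, star_div₀, Complex.star_def, Complex.conj_ofReal]
      by_cases h : (b k : ℂ) = 0
      · simp [h]
      · field_simp
        rw [Complex.conj_conj, mul_comm]
    rw [this]
    exact Complex.ofReal_re _
  have e2 : RCLike.re (star y ⬝ᵥ ((Wᴴ * ρ * W).mulVec y)) =
      ∑ j, l j * Complex.normSq (O.mulVec y j) := by
    have : star y ⬝ᵥ ((Wᴴ * ρ * W).mulVec y) =
        ((∑ j, l j * Complex.normSq (O.mulVec y j) : ℝ) : ℂ) := by
      rw [e0, ← Matrix.mulVec_mulVec, Matrix.dotProduct_mulVec, ← Matrix.star_mulVec,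
        ← Matrix.mulVec_mulVec y (Matrix.diagonal _) O, dotProduct]
      push_cast
      refine Finset.sum_congr rfl fun j _ => ?_
      rw [Matrix.mulVec_diagonal, ← Complex.mul_conj, Pi.star_apply, Complex.star_def]
      ring
    rw [this]
    exact Complex.ofReal_re _
  have e3 : O.mulVec y i = (s : ℂ) := by
    rw [Matrix.mulVec, dotProduct, hs]
    push_cast
    refine Finset.sum_congr rfl fun k _ => ?_
    rw [overlap, ← hO, ← Complex.mul_conj, ← mul_div_assoc, Complex.star_def]
  have e4 : l i * s ^ 2 ≤ v * s := by
    rw [e1, e2] at hy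
    refine le_trans ?_ hy
    have := Finset.single_le_sum (f := fun j => l j * Complex.normSq (O.mulVec y j))
      (fun j _ => mul_nonneg (hl j) (Complex.normSq_nonneg _)) (Finset.mem_univ i)
    simp only [e3, Complex.normSq_ofReal] at this
    rwa [sq]
  rcases hs0.eq_or_lt with h | h
  · rw [← h, mul_zero]
    exact hv0
  · nlinarith

theorem klTerm_ne_bot (p q : ℝ) : klTerm p q ≠ ⊥ := by
  unfold klTerm
  split_ifs
  · exact EReal.zero_ne_bot
  · exact top_ne_bot
  · exact EReal.coe_ne_bot _

theorem sum_ereal_ne_bot {ι : Type*} (s : Finset ι) {f : ι → EReal} (hf : ∀ i ∈ s, f i ≠ ⊥) :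
    ∑ i ∈ s, f i ≠ ⊥ := by
  induction s using Finset.cons_induction with
  | empty => simp
  | cons a s ha ih =>
    rw [Finset.sum_cons]
    exact EReal.add_ne_bot_iff.mpr ⟨hf a (Finset.mem_cons_self a s),
      ih fun i hi => hf i (Finset.mem_cons_of_mem hi)⟩

theorem sum_klTerm_eq_top {ι : Type*} [Fintype ι] {p q : ι → ℝ} {k : ι} (hp : p k ≠ 0)
    (hq : q k = 0) : ∑ k, klTerm (p k) (q k) = ⊤ := by
  classical
  rw [← Finset.add_sum_erase _ _ (Finset.mem_univ k)]
  have h : klTerm (p k) (q k) = ⊤ := by rw [klTerm, if_neg hp, if_pos hq]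
  rw [h]
  exact EReal.top_add_of_ne_bot (sum_ereal_ne_bot _ fun i _ => klTerm_ne_bot _ _)

theorem sum_overlap_mul_log_sub_le {n : Type*} [Fintype n]
    {w : n → n → ℝ} {l b : n → ℝ} {v : ℝ} (hv : 0 < v)
    (hw : ∀ i k, 0 ≤ w i k) (hw1 : ∀ i, ∑ k, w i k = 1) (hl : ∀ i, 0 ≤ l i) (hl1 : ∑ i, l i = 1)
    (hb : ∀ k, 0 ≤ b k) (hbl : ∀ i k, b k = 0 → w i k * l i = 0)
    (h : ∀ i, l i * ∑ k, w i k / b k ≤ v) :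
    ∑ i, ∑ k, w i k * (l i * (Real.logb 2 (l i) - Real.logb 2 (b k))) ≤ Real.logb 2 v := by
  have hlog : 0 < Real.log 2 := Real.log_pos one_lt_two
  have key : ∀ i k, w i k * (l i * (Real.log (l i) - Real.log (b k))) ≤
      w i k * l i * (Real.log v - 1) + l i * (l i * (w i k / b k)) / v := by
    intro i k
    rcases (hw i k).eq_or_lt with hw0 | hw0
    · simp [← hw0]
    rcases (hl i).eq_or_lt with hl0 | hl0
    · simp [← hl0]
    have hb0 : 0 < b k := (hb k).lt_of_ne fun hb0 =>
      (mul_pos hw0 hl0).ne' (hbl i k hb0.symm)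
    have h1 := Real.log_le_sub_one_of_pos (div_pos hl0 (mul_pos hb0 hv))
    rw [Real.log_div hl0.ne' (mul_pos hb0 hv).ne', Real.log_mul hb0.ne' hv.ne'] at h1
    have h2 := mul_le_mul_of_nonneg_left h1 (mul_pos hw0 hl0).le
    have h3 : w i k * l i * (l i / (b k * v)) = l i * (l i * (w i k / b k)) / v := by
      field_simp
    rw [← h3]
    linarith
  have h5 : ∑ i, ∑ k, w i k * (l i * (Real.log (l i) - Real.log (b k))) ≤ Real.log v := by
    calc _ ≤ ∑ i, ∑ k, (w i k * l i * (Real.log v - 1) + l i * (l i * (w i k / b k)) / v) :=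
          Finset.sum_le_sum fun i _ => Finset.sum_le_sum fun k _ => key i k
      _ = ∑ i, (l i * (Real.log v - 1) + l i * (l i * ∑ k, w i k / b k) / v) := by
          refine Finset.sum_congr rfl fun i _ => ?_
          rw [Finset.sum_add_distrib, ← Finset.sum_mul, ← Finset.sum_mul, hw1, one_mul,
            ← Finset.sum_div, ← Finset.mul_sum, ← Finset.mul_sum]
      _ ≤ ∑ i, (l i * (Real.log v - 1) + l i * v / v) := by
          refine Finset.sum_le_sum fun i _ => ?_
          have := mul_le_mul_of_nonneg_left (h i) (hl i)
          gcongr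
      _ = Real.log v := by
          simp only [mul_div_cancel_right₀ _ hv.ne']
          rw [Finset.sum_add_distrib, ← Finset.sum_mul, hl1]
          ring
  have h6 : ∑ i, ∑ k, w i k * (l i * (Real.logb 2 (l i) - Real.logb 2 (b k))) =
      (∑ i, ∑ k, w i k * (l i * (Real.log (l i) - Real.log (b k)))) / Real.log 2 := by
    simp only [Finset.sum_div, Real.logb]
    refine Finset.sum_congr rfl fun i _ => Finset.sum_congr rfl fun k _ => ?_
    ring
  rw [h6, Real.logb]
  gcongr

theorem suppLE_of_diag {ρ σ W : Matrix n n ℂ} (hρ : ρ.PosSemidef) (hW : Wᴴ * W = 1) {a : n → ℝ}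
    (h : σ * W = W * Matrix.diagonal (fun i => (a i : ℂ)))
    (hab : ∀ k, a k = 0 → (Wᴴ * ρ * W) k k = 0) : suppLE ρ σ := by
  obtain ⟨B, rfl⟩ := exists_eq_conjTranspose_mul_self hρ
  intro x hx
  have hW' : W * Wᴴ = 1 := mul_eq_one_comm.mp hW
  have h1 : ∀ k, (a k : ℂ) * (Wᴴ.mulVec x) k = 0 := by
    intro k
    have h2 : (Matrix.diagonal (fun i => (a i : ℂ)) * Wᴴ).mulVec x = 0 := by
      rw [← conjTranspose_mul_eq hW h, ← Matrix.mulVec_mulVec, hx, Matrix.mulVec_zero]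
    rw [← Matrix.mulVec_mulVec] at h2
    simpa [Matrix.mulVec_diagonal] using congrFun h2 k
  have h3 : ∀ k, a k = 0 → ∀ j, (B * W) j k = 0 := by
    intro k hk j
    have h4 := hab k hk
    have h5 : Wᴴ * (Bᴴ * B) * W = (B * W)ᴴ * (B * W) := by
      simp only [Matrix.conjTranspose_mul, Matrix.mul_assoc]
    rw [h5, Matrix.mul_apply] at h4
    simp only [Matrix.conjTranspose_apply] at h4
    have h6 := (Finset.sum_eq_zero_iff_of_nonneg fun i _ =>
      star_mul_self_nonneg ((B * W) i k)).mp h4 j (Finset.mem_univ j)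
    simpa using h6
  have h7 : (B * W).mulVec (Wᴴ.mulVec x) = 0 := by
    ext j
    rw [Matrix.mulVec, dotProduct]
    refine Finset.sum_eq_zero fun k _ => ?_
    by_cases hk : a k = 0
    · rw [h3 k hk, zero_mul]
    · have := (mul_eq_zero.mp (h1 k)).resolve_left (by exact_mod_cast hk)
      rw [this, mul_zero]
  rw [Matrix.mulVec_mulVec, Matrix.mul_assoc, hW', Matrix.mul_one] at h7
  rw [← Matrix.mulVec_mulVec, h7, Matrix.mulVec_zero]

/-- The eigenbasis of the pinched state is a measurement that loses at most the logarithm of the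
number of distinct eigenvalues of `σ`. -/
theorem exists_measurement_relEnt_le {ρ σ : Matrix n n ℂ} (hρ : ρ.PosSemidef) (hρ1 : ρ.trace = 1)
    (hσ : σ.PosSemidef) :
    ∃ M : n → Matrix n n ℂ, (∀ k, (M k).PosSemidef) ∧ ∑ k, M k = 1 ∧
      relEnt ρ σ ≤ ∑ k, klTerm ((M k * ρ).trace).re ((M k * σ).trace).re +
        ((Real.logb 2 (spec hσ.1).card : ℝ) : EReal) := by
  obtain ⟨W, a, b, hW, ha, hb⟩ := exists_unitary_diagonal_of_commute hσ.1
    (pinch_isHermitian hσ.1 hρ.1) (mul_pinch hσ.1)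
  refine ⟨fun k => W * Matrix.single k k 1 * Wᴴ, measure_basis_psd W, sum_measure_basis hW, ?_⟩
  have hU := eigenvectorUnitary_conjTranspose_mul hρ.1
  have h1 := mul_eigenvectorUnitary hρ.1
  have hl : ∀ i, 0 ≤ hρ.1.eigenvalues i := hρ.eigenvalues_nonneg
  have hl1 : ∑ i, hρ.1.eigenvalues i = 1 := by
    have := hρ.1.trace_eq_sum_eigenvalues
    rw [hρ1] at this
    have h2 := congrArg Complex.re this.symm
    rw [Complex.re_sum] at h2
    exact h2
  set U : Matrix n n ℂ := (hρ.1.eigenvectorUnitary : Matrix n n ℂ)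
  set l := hρ.1.eigenvalues
  have hbk : ∀ k, (Wᴴ * ρ * W) k k = (b k : ℂ) := by
    intro k
    rw [← conjTranspose_mul_pinch_mul_diag hσ.1 hW ha, Matrix.mul_assoc, hb, ← Matrix.mul_assoc,
      hW, Matrix.one_mul, Matrix.diagonal_apply_eq]
  have hbs : ∀ k, b k = ∑ i, overlap U W i k * l i := by
    intro k
    have := (hbk k).symm.trans (diag_eq_sum_overlap hU h1 k)
    exact_mod_cast this
  have hak : ∀ k, (Wᴴ * σ * W) k k = (a k : ℂ) := by
    intro k
    rw [Matrix.mul_assoc, ha, ← Matrix.mul_assoc, hW, Matrix.one_mul, Matrix.diagonal_apply_eq]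
  simp only [trace_measure_basis, hak, hbk, Complex.ofReal_re]
  by_cases hs : suppLE ρ σ
  swap
  · have : ∃ k, a k = 0 ∧ b k ≠ 0 := by
      by_contra hcon
      push Not at hcon
      exact hs (suppLE_of_diag hρ hW ha fun k hk => by rw [hbk, hcon k hk, Complex.ofReal_zero])
    obtain ⟨k, hk, hbk0⟩ := this
    rw [sum_klTerm_eq_top hbk0 hk, EReal.top_add_coe]
    exact le_top
  rw [relEnt, if_pos hs, trace_mul_matLog_sub hρ.1 hσ.1 hU hW h1 ha]
  have hol : ∀ i k, 0 ≤ overlap U W i k * l i := fun i k =>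
    mul_nonneg (overlap_nonneg _ _ _ _) (hl i)
  have hab : ∀ k, a k = 0 → b k = 0 := fun k hk => by
    rw [hbs]
    exact Finset.sum_eq_zero fun i _ => overlap_mul_eq_zero hs hU h1 ha hk
  have hb0 : ∀ k, 0 ≤ b k := fun k => by
    rw [hbs]
    exact Finset.sum_nonneg fun i _ => hol i k
  have hbl : ∀ i k, b k = 0 → overlap U W i k * l i = 0 := fun i k hk => by
    rw [hbs] at hk
    exact (Finset.sum_eq_zero_iff_of_nonneg fun i _ => hol i k).mp hk i (Finset.mem_univ i)
  simp only [fun k => klTerm_eq (hab k)]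
  rw [← coe_sum_ereal, ← EReal.coe_add, EReal.coe_le_coe_iff]
  have hne : Nonempty n := by
    by_contra hcon
    rw [not_nonempty_iff] at hcon
    simp at hl1
  have hv : (0 : ℝ) < (spec hσ.1).card := by
    have : (spec hσ.1).Nonempty := Finset.univ_nonempty.image _
    exact_mod_cast this.card_pos
  have hpsd : (((((spec hσ.1).card : ℝ)) : ℂ) • Matrix.diagonal (fun k => (b k : ℂ)) -
      Wᴴ * ρ * W).PosSemidef := by
    have h2 := (pinching_inequality hσ.1 hρ).smul
      (show (0 : ℂ) ≤ (((spec hσ.1).card : ℝ)⁻¹ : ℝ) by exact_mod_cast (inv_pos.mpr hv).le)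
    rw [smul_smul] at h2
    have h3 : ((((spec hσ.1).card : ℝ)⁻¹ : ℝ) : ℂ) * ((spec hσ.1).card : ℂ) = 1 := by
      exact_mod_cast inv_mul_cancel₀ hv.ne'
    rw [h3, one_smul] at h2
    have h4 := h2.conjTranspose_mul_mul_same W
    convert h4 using 1
    rw [mul_sub, sub_mul, mul_smul_comm, smul_mul_assoc, Matrix.mul_assoc _ (pinch _ _), hb,
      ← Matrix.mul_assoc, hW, Matrix.one_mul, Complex.ofReal_natCast]
  have h5 := sum_overlap_mul_log_sub_le hv (overlap_nonneg U W) (sum_overlap_right hU hW) hl hl1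
    hb0 hbl (sum_overlap_div_le hU hl hb0 h1 hv.le hpsd)
  have h6 : ∑ k, b k * (Real.logb 2 (b k) - Real.logb 2 (a k)) =
      ∑ i, ∑ k, overlap U W i k * (l i * (Real.logb 2 (b k) - Real.logb 2 (a k))) := by
    rw [Finset.sum_comm]
    refine Finset.sum_congr rfl fun k _ => ?_
    refine (congrArg (· * (Real.logb 2 (b k) - Real.logb 2 (a k))) (hbs k)).trans ?_
    simp only [Finset.sum_mul, mul_assoc]
  rw [h6, ← sub_le_iff_le_add', ← Finset.sum_sub_distrib]
  refine le_trans (le_of_eq (Finset.sum_congr rfl fun i _ => ?_)) h5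
  rw [← Finset.sum_sub_distrib]
  refine Finset.sum_congr rfl fun k _ => ?_
  ring

theorem sum_klTerm_le_measRelEnt {ι : Type*} [Fintype ι] {ρ σ : Matrix n n ℂ}
    {M : ι → Matrix n n ℂ} (hM : ∀ i, (M i).PosSemidef) (hM1 : ∑ i, M i = 1) :
    ∑ i, klTerm ((M i * ρ).trace).re ((M i * σ).trace).re ≤ measRelEnt ρ σ := by
  have h : IsPOVM (M ∘ (Fintype.equivFin ι).symm) :=
    ⟨fun x => hM _, ((Fintype.equivFin ι).symm.sum_comp M).trans hM1⟩
  rw [← (Fintype.equivFin ι).symm.sum_comp]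
  exact le_iSup_of_le _ (le_iSup_of_le _ (le_iSup_of_le h le_rfl))

theorem klTerm_sum_le {ι : Type*} [Fintype ι] {p q : ι → ℝ} (hp : ∀ i, 0 ≤ p i)
    (hq : ∀ i, 0 ≤ q i) : klTerm (∑ i, p i) (∑ i, q i) ≤ ∑ i, klTerm (p i) (q i) := by
  by_cases h : ∀ i, q i = 0 → p i = 0
  swap
  · push Not at h
    obtain ⟨i, hi, hi'⟩ := h
    rw [sum_klTerm_eq_top hi' hi]
    exact le_top
  rcases (Finset.sum_nonneg fun i (_ : i ∈ Finset.univ) => hp i).eq_or_lt with hP | hP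
  · have h0 : ∀ i, p i = 0 := fun i =>
      (Finset.sum_eq_zero_iff_of_nonneg fun i _ => hp i).mp hP.symm i (Finset.mem_univ i)
    simp [klTerm, h0]
  have hQ : 0 < ∑ i, q i := by
    refine (Finset.sum_nonneg fun i _ => hq i).lt_of_ne fun hQ => hP.ne' ?_
    exact Finset.sum_eq_zero fun i _ => h i <|
      (Finset.sum_eq_zero_iff_of_nonneg fun i _ => hq i).mp hQ.symm i (Finset.mem_univ i)
  set P := ∑ i, p i with hPdef
  set Q := ∑ i, q i with hQdef
  rw [klTerm_eq fun h => absurd h hQ.ne']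
  simp only [fun i => klTerm_eq (h i)]
  rw [← coe_sum_ereal, EReal.coe_le_coe_iff]
  have key : ∀ i, p i * (Real.log P - Real.log Q) - p i * (Real.log (p i) - Real.log (q i)) ≤
      q i * (P / Q) - p i := by
    intro i
    rcases (hp i).eq_or_lt with hp0 | hp0
    · simp only [← hp0, zero_mul, sub_zero]
      exact mul_nonneg (hq i) (div_pos hP hQ).le
    have hq0 : 0 < q i := (hq i).lt_of_ne fun h0 => hp0.ne' (h i h0.symm)
    have h1 := Real.log_le_sub_one_of_pos (div_pos (mul_pos hq0 hP) (mul_pos hp0 hQ))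
    rw [Real.log_div (mul_pos hq0 hP).ne' (mul_pos hp0 hQ).ne', Real.log_mul hq0.ne' hP.ne',
      Real.log_mul hp0.ne' hQ.ne'] at h1
    have h2 := mul_le_mul_of_nonneg_left h1 hp0.le
    have h3 : p i * (q i * P / (p i * Q)) = q i * (P / Q) := by field_simp
    rw [mul_sub _ (_ / _) 1, h3, mul_one] at h2
    linarith
  have h4 := Finset.sum_le_sum fun i (_ : i ∈ Finset.univ) => key i
  rw [Finset.sum_sub_distrib, Finset.sum_sub_distrib, ← Finset.sum_mul, ← Finset.sum_mul,
    ← hPdef, ← hQdef, mul_div_cancel₀ _ hQ.ne', sub_self, sub_nonpos] at h4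
  simp only [Real.logb, ← sub_div, mul_div_assoc', ← Finset.sum_div]
  have := Real.log_pos one_lt_two
  gcongr

/-- The average of the conjugates of `X` by the matrices `V g`. -/
def twirl {G : Type*} [Fintype G] (V : G → Matrix n n ℂ) (X : Matrix n n ℂ) : Matrix n n ℂ :=
  ∑ g, ((Fintype.card G : ℝ)⁻¹) • (V g * X * (V g)ᴴ)

theorem sum_klTerm_twirl_le {G : Type*} [Fintype G] [Nonempty G] {V : G → Matrix n n ℂ}
    (hV : ∀ g, (V g)ᴴ * V g = 1) {ρ σ : Matrix n n ℂ} (hρ : ρ.PosSemidef) (hσ : σ.PosSemidef)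
    {ι : Type*} [Fintype ι] {M : ι → Matrix n n ℂ} (hM : ∀ i, (M i).PosSemidef)
    (hM1 : ∑ i, M i = 1) :
    ∑ i, klTerm ((M i * twirl V ρ).trace).re ((M i * twirl V σ).trace).re ≤
      measRelEnt ρ σ := by
  have hc : (0 : ℝ) < (Fintype.card G : ℝ)⁻¹ := inv_pos.mpr (by exact_mod_cast Fintype.card_pos)
  set c : ℝ := (Fintype.card G : ℝ)⁻¹ with hcdef
  let N : ι × G → Matrix n n ℂ := fun x => c • ((V x.2)ᴴ * M x.1 * V x.2)
  have hN : ∀ x, (N x).PosSemidef := fun x =>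
    ((hM x.1).conjTranspose_mul_mul_same (V x.2)).smul hc.le
  have hN1 : ∑ x, N x = 1 := by
    simp only [N]
    rw [Fintype.sum_prod_type_right]
    simp only [← Finset.smul_sum, ← Finset.sum_mul, ← Finset.mul_sum, hM1, Matrix.mul_one, hV]
    rw [Finset.sum_const, Finset.card_univ, ← Nat.cast_smul_eq_nsmul ℝ, smul_smul, hcdef,
      inv_mul_cancel₀ (inv_pos.mp hc).ne', one_smul]
  have htr : ∀ i (X : Matrix n n ℂ), ((M i * twirl V X).trace).re =
      ∑ g, ((N (i, g) * X).trace).re := by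
    intro i X
    rw [twirl, Finset.mul_sum, Matrix.trace_sum, Complex.re_sum]
    refine Finset.sum_congr rfl fun g _ => ?_
    simp only [N, mul_smul_comm, smul_mul_assoc, Matrix.trace_smul]
    rw [← Matrix.mul_assoc, Matrix.trace_mul_comm]
    simp only [Matrix.mul_assoc]
    rfl
  refine le_trans ?_ (sum_klTerm_le_measRelEnt hN hN1)
  rw [Fintype.sum_prod_type]
  refine Finset.sum_le_sum fun i _ => ?_
  rw [htr, htr]
  exact klTerm_sum_le (fun g => trace_mul_re_nonneg (hN _) hρ)
    (fun g => trace_mul_re_nonneg (hN _) hσ)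

theorem twirl_mem {n : Type*} [Fintype n]
    {G : Type*} [Fintype G] [Nonempty G] {V : G → Matrix n n ℂ}
    {S : Set (Matrix n n ℂ)} (hS : Convex ℝ S) {X : Matrix n n ℂ}
    (h : ∀ g, V g * X * (V g)ᴴ ∈ S) : twirl V X ∈ S := by
  refine hS.sum_mem (fun _ _ => by positivity) ?_ fun g _ => h g
  rw [Finset.sum_const, Finset.card_univ, nsmul_eq_mul]
  exact mul_inv_cancel₀ (by exact_mod_cast Fintype.card_ne_zero)

theorem conj_twirl {n : Type*} [Fintype n] {G : Type*} [Fintype G] [Group G] {V : G → Matrix n n ℂ}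
    (hV : ∀ g h, V g * V h = V (g * h)) (X : Matrix n n ℂ) (g : G) :
    V g * twirl V X * (V g)ᴴ = twirl V X := by
  simp only [twirl, Finset.mul_sum, Finset.sum_mul, mul_smul_comm, smul_mul_assoc]
  refine Eq.trans ?_ (Equiv.sum_comp (Equiv.mulLeft g) _)
  refine Finset.sum_congr rfl fun h _ => ?_
  rw [Equiv.coe_mulLeft, ← hV, Matrix.conjTranspose_mul]
  simp only [Matrix.mul_assoc]

theorem permMat_mul (d m : ℕ) (π τ : Equiv.Perm (Fin m)) :
    permMat d m π * permMat d m τ = permMat d m (π * τ) := by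
  ext f g
  rw [Matrix.mul_apply]
  simp only [permMat, Matrix.of_apply, ite_mul, one_mul, zero_mul, Finset.sum_ite_eq,
    Finset.mem_univ, if_true]
  rfl

theorem conjTranspose_permMat_mul (d m : ℕ) (π : Equiv.Perm (Fin m)) :
    (permMat d m π)ᴴ * permMat d m π = 1 := by
  have h : (permMat d m π)ᴴ = permMat d m π⁻¹ := by
    ext f g
    simp only [permMat, Matrix.conjTranspose_apply, Matrix.of_apply]
    have : g ∘ π = f ↔ f ∘ ⇑π⁻¹ = g := by
      exact eq_comm.trans (π.comp_symm_eq g f).symm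
    simp only [this]
    split_ifs <;> simp
  rw [h, permMat_mul, inv_mul_cancel]
  ext f g
  simp [permMat, Matrix.one_apply]

theorem permMat_mul_mul_conjTranspose_apply (d m : ℕ) (π : Equiv.Perm (Fin m))
    (X : Matrix (Fin m → Fin d) (Fin m → Fin d) ℂ) (f g : Fin m → Fin d) :
    (permMat d m π * X * (permMat d m π)ᴴ) f g = X (f ∘ π) (g ∘ π) := by
  simp [Matrix.mul_apply, permMat, Matrix.conjTranspose_apply, apply_ite star]

theorem exists_perm_comp_eq {α β : Type*} [Finite α] {p q : α → β}
    (h : ∀ b, Nat.card {a // p a = b} = Nat.card {a // q a = b}) :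
    ∃ π : Equiv.Perm α, q ∘ π = p :=
  ⟨Equiv.ofFiberEquiv fun b => (Finite.card_eq.mp (h b)).some,
    funext fun a => Equiv.ofFiberEquiv_map _ a⟩

/-- The joint type of two sequences: how often each pair of letters occurs. -/
def jointType {d m : ℕ} (x : (Fin m → Fin d) × (Fin m → Fin d)) : Fin d × Fin d → Fin (m + 1) :=
  fun a => ⟨Nat.card {i // (x.1 i, x.2 i) = a},
    Nat.lt_succ_of_le ((Finite.card_subtype_le _).trans (Nat.card_fin m).le)⟩

theorem exists_perm_of_jointType_eq {d m : ℕ} {x y : (Fin m → Fin d) × (Fin m → Fin d)}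
    (h : jointType x = jointType y) :
    ∃ π : Equiv.Perm (Fin m), y.1 ∘ π = x.1 ∧ y.2 ∘ π = x.2 := by
  obtain ⟨π, hπ⟩ := exists_perm_comp_eq (p := fun i => (x.1 i, x.2 i))
    (q := fun i => (y.1 i, y.2 i)) fun a => Fin.ext_iff.mp (congrFun h a)
  exact ⟨π, funext fun i => congrArg Prod.fst (congrFun hπ i),
    funext fun i => congrArg Prod.snd (congrFun hπ i)⟩

theorem eq_zero_of_sum_smul_specProj {A : Matrix n n ℂ} (hA : A.IsHermitian) {φ : spec hA → ℂ}
    (h : ∑ a, φ a • specProj hA a = 0) : φ = 0 := by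
  have h1 : (∑ a, φ a • specProj hA a) * (hA.eigenvectorUnitary : Matrix n n ℂ) =
      (hA.eigenvectorUnitary : Matrix n n ℂ) * ∑ a : spec hA, φ a • Matrix.diagonal
        (fun i => if hA.eigenvalues i = a then (1 : ℂ) else 0) := by
    rw [Finset.sum_mul, Finset.mul_sum]
    refine Finset.sum_congr rfl fun a _ => ?_
    rw [smul_mul_assoc, mul_smul_comm, specProj, hermFun_mul hA _ (mul_eigenvectorUnitary hA)]
  rw [h, Matrix.zero_mul] at h1
  have h2 := congrArg ((hA.eigenvectorUnitary : Matrix n n ℂ)ᴴ * ·) h1.symm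
  simp only [← Matrix.mul_assoc, eigenvectorUnitary_conjTranspose_mul, Matrix.one_mul,
    Matrix.mul_zero] at h2
  ext ⟨a, ha⟩
  obtain ⟨i, -, rfl⟩ := Finset.mem_image.mp ha
  have h3 := congrFun (congrFun h2 i) i
  rw [Matrix.sum_apply, Finset.sum_eq_single ⟨hA.eigenvalues i, ha⟩] at h3
  · simpa using h3
  · intro b _ hb
    have : hA.eigenvalues i ≠ b := fun h => hb (Subtype.ext h.symm)
    simp [this]
  · simp

/-- A permutation-invariant Hermitian matrix has polynomially many distinct eigenvalues. -/
theorem card_spec_le {d m : ℕ} (hd : 1 ≤ d) {σ : Matrix (Fin m → Fin d) (Fin m → Fin d) ℂ}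
    (hσ : σ.IsHermitian) (hinv : ∀ π, permMat d m π * σ * (permMat d m π)ᴴ = σ) :
    (spec hσ).card ≤ (m + 1) ^ d ^ 2 := by
  have : NeZero d := ⟨Nat.one_le_iff_ne_zero.mp hd⟩
  have hcomm : ∀ (π : Equiv.Perm (Fin m)) (a : ℝ) (f g : Fin m → Fin d),
      specProj hσ a (f ∘ π) (g ∘ π) = specProj hσ a f g := by
    intro π a f g
    have hV : (permMat d m π)ᴴ * permMat d m π = 1 := conjTranspose_permMat_mul d m π
    have h1 : σ * permMat d m π = permMat d m π * σ := by
      conv_lhs => rw [← hinv π, Matrix.mul_assoc, hV, Matrix.mul_one]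
    have h2 : specProj hσ a * permMat d m π = permMat d m π * specProj hσ a :=
      hermFun_comm hσ _ h1
    rw [← permMat_mul_mul_conjTranspose_apply d m π (specProj hσ a) f g, ← h2,
      Matrix.mul_assoc, mul_eq_one_comm.mp hV,
      Matrix.mul_one]
  let rep : (Fin d × Fin d → Fin (m + 1)) → (Fin m → Fin d) × (Fin m → Fin d) :=
    Function.invFun jointType
  let Φ : (spec hσ → ℂ) →ₗ[ℂ] ((Fin d × Fin d → Fin (m + 1)) → ℂ) :=
    { toFun := fun φ t => ∑ a, φ a * specProj hσ a (rep t).1 (rep t).2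
      map_add' := fun φ ψ => by
        ext t
        simp only [Pi.add_apply, add_mul, Finset.sum_add_distrib]
      map_smul' := fun c φ => by
        ext t
        simp only [Pi.smul_apply, smul_eq_mul, mul_assoc, Finset.mul_sum, RingHom.id_apply] }
  have hΦ : Function.Injective Φ := by
    rw [injective_iff_map_eq_zero]
    intro φ hφ
    refine eq_zero_of_sum_smul_specProj hσ ?_
    ext f g
    obtain ⟨π, h1, h2⟩ := exists_perm_of_jointType_eq
      (x := (f, g)) (y := rep (jointType (f, g))) (Function.invFun_eq ⟨(f, g), rfl⟩).symm
    have h3 := congrFun hφ (jointType (f, g))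
    simp only [Φ, LinearMap.coe_mk, AddHom.coe_mk, Pi.zero_apply] at h3
    rw [Matrix.sum_apply, Matrix.zero_apply, ← h3]
    refine Finset.sum_congr rfl fun a _ => ?_
    simp only at h1 h2
    rw [Matrix.smul_apply, smul_eq_mul, ← hcomm π a (rep _).1 (rep _).2, h1, h2]
  have h4 := LinearMap.finrank_le_finrank_of_injective hΦ
  simpa [← sq] using h4

theorem logb_card_le {d m k : ℕ} (hd : 1 ≤ d) (hk : k ≤ (m + 1) ^ d ^ 2) :
    Real.logb 2 k ≤ 2 * ((d : ℝ) ^ 2 + d) * Real.logb 2 (m + d) := by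
  have hd' : (1 : ℝ) ≤ d := by exact_mod_cast hd
  have h0 : 0 ≤ Real.logb 2 ((m : ℝ) + 1) := Real.logb_nonneg one_lt_two (by simp)
  have h1 : Real.logb 2 ((m : ℝ) + 1) ≤ Real.logb 2 (m + d) :=
    Real.logb_le_logb_of_le one_lt_two (by positivity) (by linarith)
  have h2 : Real.logb 2 k ≤ (d : ℝ) ^ 2 * Real.logb 2 ((m : ℝ) + 1) := by
    rcases Nat.eq_zero_or_pos k with rfl | hk0
    · simpa using mul_nonneg (sq_nonneg _) h0
    calc Real.logb 2 k ≤ Real.logb 2 (((m : ℝ) + 1) ^ d ^ 2) :=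
          Real.logb_le_logb_of_le one_lt_two (by exact_mod_cast hk0) (by exact_mod_cast hk)
      _ = (d : ℝ) ^ 2 * Real.logb 2 ((m : ℝ) + 1) := by
          rw [Real.logb_pow]
          push_cast
          rfl
  refine h2.trans (mul_le_mul (by nlinarith) h1 h0 (by positivity))

theorem conj_mem_of_permInvSet {d m : ℕ} {S : Set (Matrix (Fin m → Fin d) (Fin m → Fin d) ℂ)}
    (hS : PermInvSet d m S) {X : Matrix (Fin m → Fin d) (Fin m → Fin d) ℂ} (hX : X ∈ S)
    (π : Equiv.Perm (Fin m)) : permMat d m π * X * (permMat d m π)ᴴ ∈ S := by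
  rw [← hS π]
  exact ⟨X, hX, rfl⟩

/-- finite-level approximation bounds between the Umegaki and the measured
relative entropy of two structured sequences of sets. -/
theorem relEntSet_sub_measRelEntSet_bound (d : ℕ) (hd : 1 ≤ d) (c : ℝ) (hc : 0 ≤ c)
    (A B : (n : ℕ) → Set (Matrix (Fin n → Fin d) (Fin n → Fin d) ℂ))
    (hAstate : ∀ n, 1 ≤ n → ∀ ρ ∈ A n, ρ.PosSemidef ∧ ρ.trace = 1)
    (hBpsd : ∀ n, 1 ≤ n → ∀ σ ∈ B n, σ.PosSemidef)
    (hAne : ∀ n, 1 ≤ n → (A n).Nonempty) (hBne : ∀ n, 1 ≤ n → (B n).Nonempty)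
    (hAconv : ∀ n, 1 ≤ n → Convex ℝ (A n)) (hBconv : ∀ n, 1 ≤ n → Convex ℝ (B n))
    (hAcomp : ∀ n, 1 ≤ n → IsCompact (A n)) (hBcomp : ∀ n, 1 ≤ n → IsCompact (B n))
    (hAperm : ∀ n, 1 ≤ n → PermInvSet d n (A n)) (hBperm : ∀ n, 1 ≤ n → PermInvSet d n (B n))
    (hAtens : ∀ m k, 1 ≤ m → 1 ≤ k → ∀ X ∈ A m, ∀ Y ∈ A k, tensorJoin X Y ∈ A (m + k))
    (hBtens : ∀ m k, 1 ≤ m → 1 ≤ k → ∀ X ∈ B m, ∀ Y ∈ B k, tensorJoin X Y ∈ B (m + k))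
    (hApolar : ∀ m k, 1 ≤ m → 1 ≤ k → ∀ X ∈ polarPlus (A m), ∀ Y ∈ polarPlus (A k),
      tensorJoin X Y ∈ polarPlus (A (m + k)))
    (hBpolar : ∀ m k, 1 ≤ m → 1 ≤ k → ∀ X ∈ polarPlus (B m), ∀ Y ∈ polarPlus (B k),
      tensorJoin X Y ∈ polarPlus (B (m + k)))
    (hDmax : ∀ n, 1 ≤ n →
      (⨅ ρ ∈ A n, ⨅ σ ∈ B n, Dmax ρ σ) ≤ ((c * n : ℝ) : EReal)) :
    ∀ m, 1 ≤ m →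
      measRelEntSet (A m) (B m) ≤ relEntSet (A m) (B m) ∧
      relEntSet (A m) (B m) ≤ measRelEntSet (A m) (B m) +
        ((2 * ((d : ℝ) ^ 2 + d) * Real.logb 2 (m + d) : ℝ) : EReal) := by
  intro m hm
  refine ⟨iInf₂_mono fun ρ hρ => iInf₂_mono fun σ hσ =>
    measRelEnt_le_relEnt (hAstate m hm ρ hρ).1 (hBpsd m hm σ hσ), ?_⟩
  rw [← EReal.sub_le_iff_le_add (Or.inl (EReal.coe_ne_bot _)) (Or.inl (EReal.coe_ne_top _))]
  refine le_iInf₂ fun ρ hρ => le_iInf₂ fun σ hσ => ?_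
  rw [EReal.sub_le_iff_le_add (Or.inl (EReal.coe_ne_bot _)) (Or.inl (EReal.coe_ne_top _))]
  have hρ' : twirl (permMat d m) ρ ∈ A m :=
    twirl_mem (hAconv m hm) (conj_mem_of_permInvSet (hAperm m hm) hρ)
  have hσ' : twirl (permMat d m) σ ∈ B m :=
    twirl_mem (hBconv m hm) (conj_mem_of_permInvSet (hBperm m hm) hσ)
  obtain ⟨hρ1, hρ2⟩ := hAstate m hm _ hρ'
  have hσ1 := hBpsd m hm _ hσ'
  obtain ⟨M, hM, hM1, hle⟩ := exists_measurement_relEnt_le hρ1 hρ2 hσ1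
  refine (iInf₂_le_of_le _ hρ' (iInf₂_le _ hσ')).trans (hle.trans (add_le_add ?_ ?_))
  · exact sum_klTerm_twirl_le (conjTranspose_permMat_mul d m) (hAstate m hm ρ hρ).1
      (hBpsd m hm σ hσ) hM hM1
  · exact EReal.coe_le_coe_iff.mpr
      (logb_card_le hd (card_spec_le hd hσ1.1 (conj_twirl (permMat_mul d m) σ)))

end QIT
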